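/- arXiv:2510.05499 — 5 statements merged into one kernel-verified Lean document; each statement's English description precedes it below -/
import Mathlib

section
/- Let B be a reflexive Banach space and f : B → B a C¹ diffeomorphism satisfying the C¹ regularity conditions and a generalized (C,λ)-structure with constants C > 0, λ ∈ (0,1). Then for any λ₁ ∈ (λ,1) there exist δ > 0 and C₁ > 0 such that every C¹ diffeomorphism g : B → B with ‖g − f‖_{C¹} < δ satisfies a generalized (C₁,λ₁)-structure. -/
open Set Filter

noncomputable section

variable {B : Type*} [NormedAddCommGroup B] [NormedSpace ℝ B] [CompleteSpace B]

/-- Iterated differential of `f` along the forward orbit of `x`: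
`orbitDeriv f Df n x = Df(f^{n-1} x) ∘ ⋯ ∘ Df(x)`. -/
def orbitDeriv (f : B → B) (Df : B → B →L[ℝ] B) : ℕ → B → B →L[ℝ] B
  | 0, _ => ContinuousLinearMap.id ℝ B
  | (n + 1), x => orbitDeriv f Df n (f x) ∘L Df x

/-- `f` is a `C¹` diffeomorphism with inverse `fInv`, derivative `Df` and
derivative of the inverse `DfInv`. -/
def IsC1Diffeo (f fInv : B → B) (Df DfInv : B → B →L[ℝ] B) : Prop :=
  Function.LeftInverse fInv f ∧ Function.RightInverse fInv f ∧
  (∀ x, HasFDerivAt f (Df x) x) ∧ (∀ x, HasFDerivAt fInv (DfInv x) x)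

/-- The `C¹` regularity conditions (uniform continuity and boundedness of `Df`). -/
def C1Reg (f : B → B) (Df DfInv : B → B →L[ℝ] B) (R : ℝ) (r : ℝ → ℝ) : Prop :=
  0 < R ∧ MonotoneOn r (Set.Ici 0) ∧ (∀ z, 0 ≤ z → 0 ≤ r z) ∧
  Filter.Tendsto r (nhdsWithin 0 (Set.Ioi 0)) (nhds 0) ∧
  (∀ x v : B, ‖f (x + v) - f x - Df x v‖ ≤ ‖v‖ * r ‖v‖) ∧
  (∀ x : B, ‖Df x‖ ≤ R) ∧ (∀ x : B, ‖DfInv x‖ ≤ R) ∧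
  (∀ x v : B, ‖Df (x + v) - Df x‖ ≤ r ‖v‖)

/-- Generalized `(C, λ)`-structure for a diffeomorphism `f`, with stable/unstable
projections `P x`, `Q x` (no continuity in `x` assumed). -/
def IsGenCL (f fInv : B → B) (Df DfInv : B → B →L[ℝ] B)
    (C lam : ℝ) (P Q : B → B →L[ℝ] B) : Prop :=
  (∀ x, P x + Q x = ContinuousLinearMap.id ℝ B) ∧
  (∀ x, ‖P x‖ ≤ C) ∧ (∀ x, ‖Q x‖ ≤ C) ∧
  (∀ x, Set.MapsTo (Df x) (Set.range (P x)) (Set.range (P (f x)))) ∧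
  (∀ x, Set.MapsTo (DfInv x) (Set.range (Q x)) (Set.range (Q (fInv x)))) ∧
  (∀ x (n : ℕ) (v : B), v ∈ Set.range (P x) →
      ‖orbitDeriv f Df n x v‖ ≤ C * lam ^ n * ‖v‖) ∧
  (∀ x (n : ℕ) (v : B), v ∈ Set.range (Q x) →
      ‖orbitDeriv fInv DfInv n x v‖ ≤ C * lam ^ n * ‖v‖)

/-- For an interval `I ⊆ ℤ`, `tildeI I = {k : k ∈ I and k+1 ∈ I}`. -/
def tildeI (I : Set ℤ) : Set ℤ := {k | k ∈ I ∧ k + 1 ∈ I}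

/-- Bounded solution property on `I` with constant `L`. -/
def BSP (I : Set ℤ) (A : ℤ → B →L[ℝ] B) (L : ℝ) : Prop :=
  ∀ w : ℤ → B, (∀ k ∈ tildeI I, ‖w (k + 1)‖ ≤ 1) →
    ∃ v : ℤ → B, (∀ k ∈ I, ‖v k‖ ≤ L) ∧ ∀ k ∈ tildeI I, v (k + 1) = A k (v k) + w (k + 1)

/-- Strong bounded solution property on `I` with constant `L`: the difference
operator `T_A : ℓ^∞(I,B) → ℓ^∞(Ĩ,B)` has a bounded linear right inverse of norm `≤ L`. -/
def StrongBSP (I : Set ℤ) (A : ℤ → B →L[ℝ] B) (L : ℝ) : Prop :=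
  ∃ S : BoundedContinuousFunction ℤ B →L[ℝ] BoundedContinuousFunction ℤ B,
    (∀ (w : BoundedContinuousFunction ℤ B) (M : ℝ),
        (∀ k ∈ tildeI I, ‖w (k + 1)‖ ≤ M) → ∀ k ∈ I, ‖S w k‖ ≤ L * M) ∧
    (∀ w : BoundedContinuousFunction ℤ B, ∀ k ∈ tildeI I,
        S w (k + 1) = A k (S w k) + w (k + 1))

set_option linter.unusedSectionVars false

/-- A contraction principle for families `X → Y` measured in a weighted supremum norm. -/
theorem exists_fixed_family {X Y : Type*} [NormedAddCommGroup Y] [CompleteSpace Y]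
    (Ψ : (X → Y) → X → Y) (c : X → ℝ) (hc : ∀ x, 0 ≤ c x) {q ρ : ℝ}
    (hq0 : 0 ≤ q) (hq1 : q < 1) (hρ : 0 ≤ ρ)
    (hlip : ∀ w w' : X → Y, ∀ a : ℝ, 0 ≤ a → (∀ x, ‖w x‖ ≤ ρ * c x) →
      (∀ x, ‖w' x‖ ≤ ρ * c x) → (∀ x, ‖w x - w' x‖ ≤ a * c x) →
      ∀ x, ‖Ψ w x - Ψ w' x‖ ≤ q * a * c x)
    (hzero : ∀ x, ‖Ψ 0 x‖ ≤ (1 - q) * ρ * c x) :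
    ∃ w : X → Y, (∀ x, ‖w x‖ ≤ ρ * c x) ∧ Ψ w = w := by
  set u : ℕ → X → Y := fun n => Ψ^[n] 0 with hu
  have hsucc : ∀ n, u (n + 1) = Ψ (u n) := fun n => Function.iterate_succ_apply' Ψ n 0
  have hball : ∀ n x, ‖u n x‖ ≤ ρ * c x := by
    intro n
    induction n with
    | zero => intro x; simpa [hu] using mul_nonneg hρ (hc x)
    | succ n ih =>
      intro x
      have h1 := hlip (u n) 0 ρ hρ ih (fun x => by simpa using mul_nonneg hρ (hc x))
        (fun x => by simpa using ih x) x
      have h2 := norm_le_norm_sub_add (Ψ (u n) x) (Ψ 0 x)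
      rw [hsucc]
      linarith [hzero x]
  have hdiff : ∀ n x, ‖u n x - u (n + 1) x‖ ≤ ρ * q ^ n * c x := by
    intro n
    induction n with
    | zero =>
      intro x
      have := hball 1 x
      simpa [hu] using this
    | succ n ih =>
      intro x
      have := hlip _ _ _ (by positivity) (hball n) (hball (n + 1)) ih x
      rw [← hsucc, ← hsucc] at this
      convert this using 1
      ring
  have hd : ∀ x n, dist (u n x) (u (n + 1) x) ≤ ρ * c x * q ^ n := fun x n => by
    rw [dist_eq_norm]; convert hdiff n x using 1; ring
  have hlim : ∀ x, ∃ y, Tendsto (fun n => u n x) atTop (nhds y) := fun x =>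
    cauchySeq_tendsto_of_complete (cauchySeq_of_le_geometric q _ hq1 (hd x))
  choose w hw using hlim
  have hwball : ∀ x, ‖w x‖ ≤ ρ * c x := fun x =>
    le_of_tendsto (hw x).norm (Eventually.of_forall fun n => hball n x)
  refine ⟨w, hwball, funext fun x => ?_⟩
  have hclose : ∀ n x, ‖u n x - w x‖ ≤ ρ * q ^ n / (1 - q) * c x := fun n x => by
    have := dist_le_of_le_geometric_of_tendsto q _ hq1 (hd x) (hw x) n
    rw [dist_eq_norm] at this
    convert this using 1
    ring
  have h0 : Tendsto (fun n => u (n + 1) x) atTop (nhds (Ψ w x)) := by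
    rw [tendsto_iff_norm_sub_tendsto_zero]
    refine squeeze_zero (g := fun n => q * (ρ * q ^ n / (1 - q)) * c x)
      (fun _ => norm_nonneg _)
      (fun n => by
        rw [hsucc]
        exact hlip _ _ _ (div_nonneg (by positivity) (by linarith)) (hball n) hwball
          (hclose n) x) ?_
    have := (tendsto_pow_atTop_nhds_zero_of_lt_one hq0 hq1).const_mul
      (q * (ρ / (1 - q)) * c x)
    rw [mul_zero] at this
    refine this.congr fun n => ?_
    ring
  exact tendsto_nhds_unique h0 ((tendsto_add_atTop_iff_nat 1).2 (hw x))

/-- A self-improving weighted bound improves to its fixed point. -/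
theorem norm_le_of_self_improving {X Y : Type*} [NormedAddCommGroup Y] (v : X → Y) (c : X → ℝ)
    {H D : ℝ} (hD : ∀ x, ‖v x‖ ≤ D * c x) (hD0 : 0 ≤ D) (hH : 0 ≤ H)
    (himp : ∀ D, 0 ≤ D → (∀ x, ‖v x‖ ≤ D * c x) → ∀ x, ‖v x‖ ≤ (H + D / 2) * c x) (x : X) :
    ‖v x‖ ≤ 2 * H * c x := by
  have key : ∀ k : ℕ, ∀ x, ‖v x‖ ≤ (2 * H + D * (1 / 2) ^ k) * c x := by
    intro k
    induction k with
    | zero =>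
      intro x
      have h1 := himp D hD0 hD x
      by_cases h : 0 ≤ c x
      · have := hD x
        have : 0 ≤ H * c x := mul_nonneg hH h
        simp only [pow_zero]
        nlinarith
      · have := hD x
        have h3 := norm_nonneg (v x)
        have : (H + D / 2) * c x ≤ 0 := mul_nonpos_of_nonneg_of_nonpos (by positivity)
          (by linarith)
        have h4 : ‖v x‖ = 0 := by linarith
        have : (H + D / 2) * c x = 0 := by linarith
        simp only [pow_zero]
        linarith
    | succ k ih =>
      intro x
      convert himp _ (by positivity) ih x using 1
      ring
  have h1 := ((tendsto_pow_atTop_nhds_zero_of_lt_one (r := (1 / 2 : ℝ)) (by norm_num)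
    (by norm_num)).const_mul D).const_add (2 * H) |>.mul_const (c x)
  rw [mul_zero, add_zero] at h1
  exact ge_of_tendsto' h1 fun k => key k x

/-- The exponential kernel `lam ^ |n - (j + 1)|`. -/
def expKernel (lam : ℝ) (n j : ℕ) : ℝ :=
  if j < n then lam ^ (n - 1 - j) else lam ^ (j + 1 - n)

theorem expKernel_nonneg {lam : ℝ} (h0 : 0 ≤ lam) (n j : ℕ) : 0 ≤ expKernel lam n j := by
  unfold expKernel
  split_ifs <;> positivity

theorem sum_expKernel_le {lam lam₁ : ℝ} (h0 : 0 ≤ lam) (h1 : lam < lam₁) (h2 : lam₁ ≤ 1)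
    (n m : ℕ) :
    ∑ j ∈ Finset.range m, expKernel lam n j * lam₁ ^ j ≤
      (1 / (lam₁ - lam) + 1 / (1 - lam)) * lam₁ ^ n := by
  have hl : 0 ≤ lam₁ := h0.trans h1.le
  have hnn : ∀ j, 0 ≤ expKernel lam n j * lam₁ ^ j := fun j =>
    mul_nonneg (expKernel_nonneg h0 n j) (by positivity)
  have hmono : ∑ j ∈ Finset.range m, expKernel lam n j * lam₁ ^ j ≤
      ∑ j ∈ Finset.range (n + m), expKernel lam n j * lam₁ ^ j :=
    Finset.sum_le_sum_of_subset_of_nonneg (Finset.range_mono (by omega)) fun j _ _ => hnn j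
  rw [Finset.sum_range_add] at hmono
  have hA : ∑ j ∈ Finset.range n, expKernel lam n j * lam₁ ^ j ≤
      1 / (lam₁ - lam) * lam₁ ^ n := by
    have hg := geom_sum₂_mul lam₁ lam n
    have he : ∑ j ∈ Finset.range n, expKernel lam n j * lam₁ ^ j =
        ∑ i ∈ Finset.range n, lam₁ ^ i * lam ^ (n - 1 - i) :=
      Finset.sum_congr rfl fun j hj => by
        rw [expKernel, if_pos (Finset.mem_range.1 hj), mul_comm]
    rw [he, one_div, inv_mul_eq_div, le_div_iff₀ (by linarith), hg]
    linarith [pow_nonneg h0 n]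
  have hB : ∑ j ∈ Finset.range m, expKernel lam n (n + j) * lam₁ ^ (n + j) ≤
      1 / (1 - lam) * lam₁ ^ n := by
    calc _ ≤ ∑ j ∈ Finset.range m, lam ^ j * lam₁ ^ n := by
          refine Finset.sum_le_sum fun j _ => ?_
          rw [expKernel, if_neg (by omega), show n + j + 1 - n = j + 1 by omega]
          refine mul_le_mul ?_ ?_ (by positivity) (by positivity)
          · exact pow_le_pow_of_le_one h0 (by linarith) (by omega)
          · exact pow_le_pow_of_le_one hl h2 (by omega)
      _ = (∑ j ∈ Finset.range m, lam ^ j) * lam₁ ^ n := by rw [Finset.sum_mul]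
      _ ≤ _ := by
          refine mul_le_mul_of_nonneg_right ?_ (by positivity)
          have hg := geom_sum_mul lam m
          rw [one_div, inv_eq_one_div, le_div_iff₀ (by linarith)]
          nlinarith [pow_nonneg h0 m]
  linarith

theorem orbitDeriv_succ_left (f : B → B) (A : B → B →L[ℝ] B) (n : ℕ) (x : B) :
    orbitDeriv f A (n + 1) x = A (f^[n] x) ∘L orbitDeriv f A n x := by
  induction n generalizing x with
  | zero => rfl
  | succ n ih =>
    rw [orbitDeriv, ih, orbitDeriv, Function.iterate_succ_apply, ContinuousLinearMap.comp_assoc]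

theorem orbitDeriv_semiconj {f g h : B → B} (hfg : Function.Semiconj h g f)
    (A : B → B →L[ℝ] B) (n : ℕ) (x : B) :
    orbitDeriv g (fun y => A (h y)) n x = orbitDeriv f A n (h x) := by
  induction n generalizing x with
  | zero => rfl
  | succ n ih => rw [orbitDeriv, orbitDeriv, ih, hfg x]

/-- The Green kernel at times `(n, j)` of the cocycle `A` along the orbit of `x`. -/
def green (g gInv : B → B) (A Ainv P Q : B → B →L[ℝ] B) (x : B) (n j : ℕ) : B →L[ℝ] B :=
  if j ≤ n then orbitDeriv g A (n - j) (g^[j] x) ∘L P (g^[j] x)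
  else -(orbitDeriv gInv Ainv (j - n) (g^[j] x) ∘L Q (g^[j] x))

section Green

variable {g gInv : B → B} {A Ainv P Q : B → B →L[ℝ] B} {C lam : ℝ}

theorem green_zero_right (x : B) (n : ℕ) :
    green g gInv A Ainv P Q x n 0 = orbitDeriv g A n x ∘L P x := by
  simp [green]

theorem green_shift (x : B) (n j : ℕ) :
    green g gInv A Ainv P Q x (n + 1) (j + 1) = green g gInv A Ainv P Q (g x) n j := by
  simp only [green, Nat.add_le_add_iff_right, Nat.add_sub_add_right, Function.iterate_succ_apply]

theorem green_succ (hg : Function.LeftInverse gInv g)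
    (hPQ : ∀ x, P x + Q x = ContinuousLinearMap.id ℝ B)
    (hA : ∀ x, A x ∘L Ainv (g x) = ContinuousLinearMap.id ℝ B) (x : B) (n j : ℕ) :
    green g gInv A Ainv P Q x (n + 1) j = A (g^[n] x) ∘L green g gInv A Ainv P Q x n j +
      if j = n + 1 then ContinuousLinearMap.id ℝ B else 0 := by
  rcases lt_trichotomy j (n + 1) with h | rfl | h
  · obtain ⟨k, rfl⟩ := Nat.exists_eq_add_of_le (Nat.lt_succ_iff.1 h)
    rw [green, green, if_pos (by omega), if_pos (by omega), if_neg (by omega), add_zero,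
      show j + k + 1 - j = k + 1 by omega, show j + k - j = k by omega, orbitDeriv_succ_left,
      ← Function.iterate_add_apply, add_comm k j, ContinuousLinearMap.comp_assoc]
  · rw [green, green, if_pos le_rfl, if_neg (by omega), if_pos rfl, Nat.sub_self,
      show n + 1 - n = 0 + 1 by omega, orbitDeriv_succ_left]
    simp only [orbitDeriv, Function.iterate_succ_apply', Function.iterate_zero, id]
    rw [ContinuousLinearMap.comp_id, ContinuousLinearMap.comp_neg, ← ContinuousLinearMap.comp_assoc,
      hA]
    exact eq_neg_add_of_add_eq (by
      rw [add_comm, ContinuousLinearMap.id_comp, ContinuousLinearMap.id_comp, hPQ])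
  · obtain ⟨k, rfl⟩ := Nat.exists_eq_add_of_lt h
    have hk : gInv^[k + 1] (g^[n + 1 + k + 1] x) = g (g^[n] x) := by
      rw [show n + 1 + k + 1 = (k + 1) + (n + 1) by omega, Function.iterate_add_apply g,
        hg.iterate (k + 1), Function.iterate_succ_apply']
    rw [green, green, if_neg (by omega), if_neg (by omega), if_neg (by omega), add_zero,
      show n + 1 + k + 1 - (n + 1) = k + 1 by omega,
      show n + 1 + k + 1 - n = k + 1 + 1 by omega, orbitDeriv_succ_left gInv Ainv (k + 1), hk,
      ContinuousLinearMap.comp_neg, ← ContinuousLinearMap.comp_assoc,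
      ← ContinuousLinearMap.comp_assoc, hA, ContinuousLinearMap.id_comp]

theorem norm_green_le (hlam : 0 ≤ lam) (hC : 0 ≤ C)
    (hCL : IsGenCL g gInv A Ainv C lam P Q) (x : B) (n j : ℕ) :
    ‖green g gInv A Ainv P Q x n (j + 1)‖ ≤ C ^ 2 * expKernel lam n j := by
  obtain ⟨-, hP, hQ, -, -, hs, hu⟩ := hCL
  refine ContinuousLinearMap.opNorm_le_bound _
    (mul_nonneg (by positivity) (expKernel_nonneg hlam n j)) fun v => ?_
  rw [green, expKernel]
  by_cases h : j < n
  · rw [if_pos h, if_pos (by omega), show n - (j + 1) = n - 1 - j by omega]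
    calc _ ≤ C * lam ^ (n - 1 - j) * ‖P (g^[j + 1] x) v‖ := hs _ _ _ ⟨v, rfl⟩
      _ ≤ C * lam ^ (n - 1 - j) * (C * ‖v‖) := by
          gcongr; exact (P _).le_of_opNorm_le (hP _) v
      _ = _ := by ring
  · rw [if_neg h, if_neg (by omega), neg_apply, norm_neg]
    calc _ ≤ C * lam ^ (j + 1 - n) * ‖Q (g^[j + 1] x) v‖ := hu _ _ _ ⟨v, rfl⟩
      _ ≤ C * lam ^ (j + 1 - n) * (C * ‖v‖) := by
          gcongr; exact (Q _).le_of_opNorm_le (hQ _) v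
      _ = _ := by ring

end Green

section LyapunovPerron

variable {lam lam₁ M : ℝ}

theorem summable_expKernel_and_norm_tsum_le {Y : Type*} [NormedAddCommGroup Y] [CompleteSpace Y]
    (h0 : 0 ≤ lam) (h1 : lam < lam₁) (h2 : lam₁ ≤ 1) (hM : 0 ≤ M) (n : ℕ) (t : ℕ → Y)
    (ht : ∀ j, ‖t j‖ ≤ M * (expKernel lam n j * lam₁ ^ j)) :
    Summable t ∧ ‖∑' j, t j‖ ≤ M * (1 / (lam₁ - lam) + 1 / (1 - lam)) * lam₁ ^ n := by
  have hsum : Summable fun j => expKernel lam n j * lam₁ ^ j :=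
    summable_of_sum_range_le
      (fun j => mul_nonneg (expKernel_nonneg h0 n j) (pow_nonneg (h0.trans h1.le) j))
      (sum_expKernel_le h0 h1 h2 n)
  refine ⟨Summable.of_norm_bounded (hsum.mul_left M) ht, ?_⟩
  refine (tsum_of_norm_bounded (hsum.mul_left M).hasSum ht).trans ?_
  rw [tsum_mul_left, mul_assoc]
  gcongr
  exact hsum.tsum_le_of_sum_range_le (sum_expKernel_le h0 h1 h2 n)

variable {T : ℕ → ℕ → B →L[ℝ] B} {θ : ℝ}

theorem norm_apply_le_expKernel (hT : ∀ n j, ‖T n j‖ ≤ M * expKernel lam n j)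
    {v : ℕ → B} {D : ℝ} (hv : ∀ n, ‖v n‖ ≤ D * lam₁ ^ n) (n j : ℕ) :
    ‖T n j (v j)‖ ≤ M * D * (expKernel lam n j * lam₁ ^ j) :=
  calc _ ≤ ‖T n j‖ * ‖v j‖ := (T n j).le_opNorm _
    _ ≤ M * expKernel lam n j * (D * lam₁ ^ j) :=
      mul_le_mul (hT n j) (hv j) (norm_nonneg _) ((norm_nonneg _).trans (hT n j))
    _ = _ := by ring

theorem norm_comp_le_expKernel (hT : ∀ n j, ‖T n j‖ ≤ M * expKernel lam n j)
    {V : ℕ → B →L[ℝ] B} {D : ℝ} (hV : ∀ n, ‖V n‖ ≤ D * lam₁ ^ n) (n j : ℕ) :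
    ‖T n j ∘L V j‖ ≤ M * D * (expKernel lam n j * lam₁ ^ j) :=
  calc _ ≤ ‖T n j‖ * ‖V j‖ := ContinuousLinearMap.opNorm_comp_le _ _
    _ ≤ M * expKernel lam n j * (D * lam₁ ^ j) :=
      mul_le_mul (hT n j) (hV j) (norm_nonneg _) ((norm_nonneg _).trans (hT n j))
    _ = _ := by ring

/-- The Lyapunov–Perron equation has an exponentially decaying solution. -/
theorem exists_lyapunovPerron (h0 : 0 ≤ lam) (h1 : lam < lam₁) (h2 : lam₁ ≤ 1) (hM : 0 ≤ M)
    (hT : ∀ n j, ‖T n j‖ ≤ M * expKernel lam n j)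
    (hθ : M * (1 / (lam₁ - lam) + 1 / (1 - lam)) ≤ 1 / 2)
    (H : ℕ → B →L[ℝ] B) {K : ℝ} (hK : 0 ≤ K) (hH : ∀ n, ‖H n‖ ≤ K * lam₁ ^ n) :
    ∃ V : ℕ → B →L[ℝ] B, (∀ n, ‖V n‖ ≤ 2 * K * lam₁ ^ n) ∧
      ∀ n, V n = H n + ∑' j, T n j ∘L V j := by
  have hl : 0 ≤ lam₁ := h0.trans h1.le
  obtain ⟨V, hV, hfix⟩ := exists_fixed_family
    (fun (V : ℕ → B →L[ℝ] B) n => H n + ∑' j, T n j ∘L V j) (fun n => lam₁ ^ n)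
    (fun n => by positivity) (q := 1 / 2) (ρ := 2 * K) (by norm_num) (by norm_num)
    (by positivity)
    (fun w w' a ha hw hw' hd n => by
      have hs := fun (u : ℕ → B →L[ℝ] B) (D : ℝ) (hD : 0 ≤ D) (hu : ∀ n, ‖u n‖ ≤ D * lam₁ ^ n) =>
        summable_expKernel_and_norm_tsum_le h0 h1 h2 (mul_nonneg hM hD) n _
          (norm_comp_le_expKernel hT hu n)
      rw [add_sub_add_left_eq_sub, ← (hs w _ (by positivity) hw).1.tsum_sub
        (hs w' _ (by positivity) hw').1]
      simp_rw [← ContinuousLinearMap.comp_sub]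
      refine (hs (fun j => w j - w' j) a ha hd).2.trans
        (mul_le_mul_of_nonneg_right ?_ (by positivity))
      nlinarith)
    (fun n => by
      simpa using (hH n).trans (by linarith))
  exact ⟨V, hV, fun n => (congrFun hfix n).symm⟩

/-- A priori bound for decaying solutions of the Lyapunov–Perron equation. -/
theorem lyapunovPerron_norm_le (h0 : 0 ≤ lam) (h1 : lam < lam₁) (h2 : lam₁ ≤ 1) (hM : 0 ≤ M)
    (hT : ∀ n j, ‖T n j‖ ≤ M * expKernel lam n j)
    (hθ : M * (1 / (lam₁ - lam) + 1 / (1 - lam)) ≤ 1 / 2)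
    {v h : ℕ → B} {D H : ℝ} (hD : 0 ≤ D) (hH : 0 ≤ H) (hv : ∀ n, ‖v n‖ ≤ D * lam₁ ^ n)
    (hh : ∀ n, ‖h n‖ ≤ H * lam₁ ^ n) (heq : ∀ n, v n = h n + ∑' j, T n j (v j)) (n : ℕ) :
    ‖v n‖ ≤ 2 * H * lam₁ ^ n := by
  have hl : 0 ≤ lam₁ := h0.trans h1.le
  refine norm_le_of_self_improving v (fun n => lam₁ ^ n) hv hD hH (fun D hD hv n => ?_) n
  have hs := (summable_expKernel_and_norm_tsum_le h0 h1 h2 (mul_nonneg hM hD) n _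
    (norm_apply_le_expKernel hT hv n)).2
  rw [heq n]
  refine (norm_add_le _ _).trans ?_
  rw [add_mul]
  refine add_le_add (hh n) (hs.trans ?_)
  gcongr
  nlinarith

end LyapunovPerron

/-- Persistence of the stable subspaces of a generalized `(C, λ)`-structure under small
perturbations of the cocycle. -/
theorem IsGenCL.exists_perturbed_stable {g gInv : B → B} {A Ainv A' P Q : B → B →L[ℝ] B}
    {C lam lam₁ η θ : ℝ} (hC : 0 < C) (hlam : 0 < lam) (h1 : lam < lam₁) (h2 : lam₁ < 1)
    (hη : 0 ≤ η) (hθ : C ^ 2 * η * (1 / (lam₁ - lam) + 1 / (1 - lam)) ≤ θ) (hθ2 : θ ≤ 1 / 2)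
    (hg : Function.LeftInverse gInv g)
    (hA : ∀ x, A x ∘L Ainv (g x) = ContinuousLinearMap.id ℝ B)
    (hA' : ∀ x, ‖A' x - A x‖ ≤ η) (hCL : IsGenCL g gInv A Ainv C lam P Q) :
    ∃ U : B → B →L[ℝ] B,
      (∀ x w, ‖U x w - P x w‖ ≤ 2 * C * θ * ‖P x w‖) ∧
      (∀ x n w, ‖orbitDeriv g A' n x (U x w)‖ ≤ 2 * C * lam₁ ^ n * ‖P x w‖) ∧
      ∀ x, Set.MapsTo (A' x) (Set.range (U x)) (Set.range (U (g x))) := by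
  have hl : 0 < lam₁ := hlam.trans h1
  have hM : 0 ≤ C ^ 2 * η := by positivity
  have hκ : C ^ 2 * η * (1 / (lam₁ - lam) + 1 / (1 - lam)) ≤ 1 / 2 := hθ.trans hθ2
  obtain ⟨hPQ, hP, -, hinv, -, hs, -⟩ := id hCL
  set G := green g gInv A Ainv P Q with hG
  set T : B → ℕ → ℕ → B →L[ℝ] B :=
    fun x n j => G x n (j + 1) ∘L (A' (g^[j] x) - A (g^[j] x)) with hTdef
  have hT : ∀ x n j, ‖T x n j‖ ≤ C ^ 2 * η * expKernel lam n j := fun x n j =>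
    calc _ ≤ ‖G x n (j + 1)‖ * ‖A' (g^[j] x) - A (g^[j] x)‖ :=
          ContinuousLinearMap.opNorm_comp_le _ _
      _ ≤ C ^ 2 * expKernel lam n j * η :=
          mul_le_mul (norm_green_le hlam.le hC.le hCL x n j) (hA' _) (norm_nonneg _)
            (mul_nonneg (by positivity) (expKernel_nonneg hlam.le n j))
      _ = _ := by ring
  have hGzero : ∀ x n w, ‖G x n 0 w‖ ≤ C * ‖P x w‖ * lam₁ ^ n := fun x n w => by
    rw [hG, green_zero_right]
    calc _ ≤ C * lam ^ n * ‖P x w‖ := hs x n _ ⟨w, rfl⟩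
      _ ≤ C * lam₁ ^ n * ‖P x w‖ := by gcongr
      _ = _ := by ring
  have hH : ∀ x n, ‖G x n 0‖ ≤ C ^ 2 * lam₁ ^ n := fun x n =>
    ContinuousLinearMap.opNorm_le_bound _ (by positivity) fun w =>
      (hGzero x n w).trans (by
        have := (P x).le_of_opNorm_le (hP x) w
        calc _ ≤ C * (C * ‖w‖) * lam₁ ^ n := by gcongr
          _ = _ := by ring)
  have hex := fun x => exists_lyapunovPerron hlam.le h1 h2.le hM (hT x) hκ (fun n => G x n 0)
    (sq_nonneg C) (hH x)
  choose V hVb hVeq using hex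
  have hbound : ∀ x w n, ‖V x n w‖ ≤ 2 * C ^ 2 * ‖w‖ * lam₁ ^ n := fun x w n =>
    ((V x n).le_of_opNorm_le (hVb x n) w).trans (le_of_eq (by ring))
  have hVapp : ∀ x n w, V x n w = G x n 0 w + ∑' j, T x n j (V x j w) := fun x n w => by
    have hsum := (summable_expKernel_and_norm_tsum_le hlam.le h1 h2.le
      (mul_nonneg hM (by positivity)) n _ (norm_comp_le_expKernel (hT x) (hVb x) n)).1
    have := congrArg (ContinuousLinearMap.apply ℝ B w) (hVeq x n)
    rw [map_add, ContinuousLinearMap.map_tsum _ hsum] at this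
    simpa using this
  have hsumm : ∀ x n w, Summable fun j => T x n j (V x j w) := fun x n w =>
    (summable_expKernel_and_norm_tsum_le hlam.le h1 h2.le
      (mul_nonneg hM (by positivity)) n _ (norm_apply_le_expKernel (hT x) (hbound x w) n)).1
  have hVle : ∀ x n w, ‖V x n w‖ ≤ 2 * (C * ‖P x w‖) * lam₁ ^ n := fun x n w =>
    lyapunovPerron_norm_le hlam.le h1 h2.le hM (hT x) hκ (by positivity) (by positivity)
      (hbound x w) (fun n => hGzero x n w) (fun n => hVapp x n w) n
  have hstep : ∀ x n w, V x (n + 1) w = A' (g^[n] x) (V x n w) := fun x n w => by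
    have hterm : ∀ j, T x (n + 1) j (V x j w) = A (g^[n] x) (T x n j (V x j w)) +
        if j = n then (A' (g^[n] x) - A (g^[n] x)) (V x n w) else 0 := fun j => by
      simp only [hTdef, hG, green_succ hg hPQ hA]
      by_cases hj : j = n
      · subst hj; simp; abel
      · simp [hj]
    rw [hVapp x (n + 1), tsum_congr hterm, ((A (g^[n] x)).summable (hsumm x n w)).tsum_add
      (summable_of_ne_finset_zero (s := {n}) fun j hj => if_neg (by simpa using hj)),
      tsum_ite_eq, ← ContinuousLinearMap.map_tsum _ (hsumm x n w)]
    have h0 : G x (n + 1) 0 w = A (g^[n] x) (G x n 0 w) := by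
      simp [hG, green_succ hg hPQ hA]
    rw [h0, ← add_assoc, ← map_add, ← hVapp, sub_apply]
    abel
  have horbit : ∀ x n w, V x n w = orbitDeriv g A' n x (V x 0 w) := fun x n w => by
    induction n with
    | zero => rfl
    | succ n ih => rw [hstep, ih, orbitDeriv_succ_left]; rfl
  refine ⟨fun x => V x 0, fun x w => ?_, fun x n w => ?_, ?_⟩
  · have hb := (summable_expKernel_and_norm_tsum_le hlam.le h1 h2.le
      (mul_nonneg hM (by positivity)) 0 _
      (norm_apply_le_expKernel (hT x) (fun n => hVle x n w) 0)).2
    have h0 : G x 0 0 w = P x w := by simp [hG, green, orbitDeriv]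
    rw [hVapp x 0 w, h0, add_sub_cancel_left]
    refine hb.trans ?_
    rw [pow_zero, mul_one]
    calc _ = C ^ 2 * η * (1 / (lam₁ - lam) + 1 / (1 - lam)) * (2 * (C * ‖P x w‖)) := by ring
      _ ≤ θ * (2 * (C * ‖P x w‖)) := by gcongr
      _ = _ := by ring
  · rw [← horbit]
    exact (hVle x n w).trans (le_of_eq (by ring))
  · rintro x _ ⟨w, rfl⟩
    obtain ⟨w₂, hw₂⟩ := hinv x ⟨w, rfl⟩
    set w₁ := w₂ + (A' x - A x) (V x 0 w) with hw₁
    refine ⟨w₁, ?_⟩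
    have hshift : ∀ n, V x (n + 1) w = G (g x) n 0 w₁ + ∑' j, T (g x) n j (V x (j + 1) w) := by
      intro n
      have hG0 : G x (n + 1) 0 w = G (g x) n 0 w₂ := by
        rw [hG, green_zero_right, green_zero_right, orbitDeriv]
        simp only [ContinuousLinearMap.comp_apply, hw₂]
      have hT0 : T x (n + 1) 0 (V x 0 w) = G (g x) n 0 ((A' x - A x) (V x 0 w)) := by
        simp only [hTdef, hG, green_shift, ContinuousLinearMap.comp_apply, Function.iterate_zero,
          id]
      rw [hVapp x (n + 1), (hsumm x (n + 1) w).tsum_eq_zero_add, hG0, hT0, hw₁, map_add, add_assoc]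
      simp only [hTdef, hG, green_shift, Function.iterate_succ_apply]
    have hb1 : ∀ n, ‖V x (n + 1) w‖ ≤ 2 * C ^ 2 * ‖w‖ * lam₁ ^ n := fun n =>
      (hbound x w (n + 1)).trans (mul_le_mul_of_nonneg_left
        (pow_le_pow_of_le_one hl.le h2.le n.le_succ) (by positivity))
    have hzero := lyapunovPerron_norm_le hlam.le h1 h2.le hM (hT (g x)) hκ
      (v := fun n => V (g x) n w₁ - V x (n + 1) w) (h := fun _ => 0)
      (D := 2 * C ^ 2 * ‖w₁‖ + 2 * C ^ 2 * ‖w‖) (H := 0) (by positivity) le_rfl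
      (fun n => (norm_sub_le _ _).trans (by rw [add_mul]; exact add_le_add (hbound _ _ n) (hb1 n)))
      (fun n => by simp)
      (fun n => by
        have hs1 := (summable_expKernel_and_norm_tsum_le hlam.le h1 h2.le
          (mul_nonneg hM (by positivity)) n _ (norm_apply_le_expKernel (hT (g x)) hb1 n)).1
        simp only [map_sub]
        rw [(hsumm (g x) n w₁).tsum_sub hs1, hVapp (g x) n w₁, hshift n]
        abel) 0
    have := norm_le_zero_iff.1 (hzero.trans (by simp))
    rw [sub_eq_zero.1 this, hstep]
    rfl

theorem IsGenCL.symm {g gInv : B → B} {A Ainv P Q : B → B →L[ℝ] B} {C lam : ℝ}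
    (h : IsGenCL g gInv A Ainv C lam P Q) : IsGenCL gInv g Ainv A C lam Q P := by
  obtain ⟨hPQ, hP, hQ, hs, hu, hds, hdu⟩ := h
  exact ⟨fun x => by rw [add_comm, hPQ], hQ, hP, hu, hs, hdu, hds⟩

theorem exists_inverse_of_norm_sub_id_le {W : B →L[ℝ] B}
    (hW : ‖W - ContinuousLinearMap.id ℝ B‖ ≤ 1 / 2) :
    ∃ S : B →L[ℝ] B, W ∘L S = ContinuousLinearMap.id ℝ B ∧
      S ∘L W = ContinuousLinearMap.id ℝ B ∧ ‖S‖ ≤ 2 := by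
  have hlt : ‖(1 : B →L[ℝ] B) - W‖ < 1 := by
    rw [norm_sub_rev]; exact lt_of_le_of_lt hW (by norm_num)
  set u := Units.oneSub (1 - W) hlt with hu
  have huW : (u : B →L[ℝ] B) = W := by simp [hu]
  have h1 : W ∘L (↑u⁻¹ : B →L[ℝ] B) = ContinuousLinearMap.id ℝ B := by
    have := u.mul_inv; rwa [huW] at this
  have h2 : (↑u⁻¹ : B →L[ℝ] B) ∘L W = ContinuousLinearMap.id ℝ B := by
    have := u.inv_mul; rwa [huW] at this
  refine ⟨_, h1, h2, ContinuousLinearMap.opNorm_le_bound _ (by norm_num) fun v => ?_⟩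
  set s := (↑u⁻¹ : B →L[ℝ] B) v
  have hs : W s = v := congrArg (fun T : B →L[ℝ] B => T v) h1
  have h3 := (W - ContinuousLinearMap.id ℝ B).le_of_opNorm_le hW s
  rw [sub_apply, hs, ContinuousLinearMap.id_apply, norm_sub_rev] at h3
  linarith [norm_le_norm_sub_add s v]

/-- Robustness of generalized `(C, λ)`-structures of a cocycle over a fixed bijection. -/
theorem IsGenCL.exists_perturbed {g gInv : B → B} {A Ainv A' Ainv' P Q : B → B →L[ℝ] B}
    {C lam lam₁ η θ : ℝ} (hC : 0 < C) (hlam : 0 < lam) (h1 : lam < lam₁) (h2 : lam₁ < 1)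
    (hη : 0 ≤ η) (hθ : C ^ 2 * η * (1 / (lam₁ - lam) + 1 / (1 - lam)) ≤ θ)
    (hθ1 : θ * (2 + 4 * C + 8 * C ^ 2) ≤ 1)
    (hg : Function.LeftInverse gInv g) (hg' : Function.RightInverse gInv g)
    (hA : ∀ x, A x ∘L Ainv (g x) = ContinuousLinearMap.id ℝ B)
    (hAinv : ∀ x, Ainv (g x) ∘L A x = ContinuousLinearMap.id ℝ B)
    (hA' : ∀ x, ‖A' x - A x‖ ≤ η) (hAinv' : ∀ x, ‖Ainv' x - Ainv x‖ ≤ η)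
    (hCL : IsGenCL g gInv A Ainv C lam P Q) :
    ∃ P' Q' : B → B →L[ℝ] B, IsGenCL g gInv A' Ainv' (4 * C + 2) lam₁ P' Q' := by
  have hθ0 : 0 ≤ θ := le_trans (mul_nonneg (by positivity) (add_nonneg
    (one_div_nonneg.2 (by linarith)) (one_div_nonneg.2 (by linarith)))) hθ
  have hθC : 0 ≤ θ * C := by positivity
  have hθC2 : 0 ≤ θ * C ^ 2 := by positivity
  have hl : 0 < lam₁ := hlam.trans h1
  obtain ⟨U, hU, hUd, hUi⟩ := hCL.exists_perturbed_stable hC hlam h1 h2 hη hθ (by nlinarith)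
    hg hA hA'
  obtain ⟨Z, hZ, hZd, hZi⟩ := hCL.symm.exists_perturbed_stable hC hlam h1 h2 hη hθ
    (by nlinarith) hg' (fun x => by simpa only [hg' x] using hAinv (gInv x)) hAinv'
  obtain ⟨hPQ, hP, hQ, -⟩ := hCL
  have hnear : ∀ {P U : B →L[ℝ] B}, ‖P‖ ≤ C → (∀ w, ‖U w - P w‖ ≤ 2 * C * θ * ‖P w‖) →
      ‖U - P‖ ≤ 1 / 4 := fun {P U} hP hU =>
    ContinuousLinearMap.opNorm_le_bound _ (by norm_num) fun w => by
      have := P.le_of_opNorm_le hP w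
      calc _ ≤ 2 * C * θ * ‖P w‖ := hU w
        _ ≤ 2 * C * θ * (C * ‖w‖) := by gcongr
        _ = 2 * (θ * C ^ 2) * ‖w‖ := by ring
        _ ≤ _ := by gcongr; nlinarith
  have hlarge : ∀ {P U : B →L[ℝ] B}, (∀ w, ‖U w - P w‖ ≤ 2 * C * θ * ‖P w‖) → ∀ w,
      ‖P w‖ ≤ 2 * ‖U w‖ := fun {P U} hU w => by
    have h3 := hU w
    have h4 := norm_le_norm_add_norm_sub (U w) (P w)
    have : 2 * C * θ * ‖P w‖ ≤ 1 / 2 * ‖P w‖ := by gcongr; nlinarith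
    linarith
  have hUn := fun x => hnear (hP x) (hU x)
  have hZn := fun x => hnear (hQ x) (hZ x)
  have hW : ∀ x, ‖U x + Z x - ContinuousLinearMap.id ℝ B‖ ≤ 1 / 2 := fun x => by
    rw [← hPQ x, add_sub_add_comm]
    exact (norm_add_le _ _).trans (by linarith [hUn x, hZn x])
  choose S hWS hSW hS using fun x => exists_inverse_of_norm_sub_id_le (hW x)
  have hbd : ∀ {P U S : B →L[ℝ] B}, ‖P‖ ≤ C → ‖U - P‖ ≤ 1 / 4 → ‖S‖ ≤ 2 →
      ‖U ∘L S‖ ≤ 4 * C + 2 := fun {P U S} hP hUP hS => by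
    have h3 : ‖U‖ ≤ C + 1 / 4 := by linarith [norm_le_norm_sub_add U P]
    calc _ ≤ ‖U‖ * ‖S‖ := ContinuousLinearMap.opNorm_comp_le _ _
      _ ≤ (C + 1 / 4) * 2 := by gcongr
      _ ≤ _ := by linarith
  have hrange : ∀ (Y : B → B →L[ℝ] B) x, Set.range (Y x ∘L S x) = Set.range (Y x) := by
    intro Y x
    apply Set.Subset.antisymm
    · rintro _ ⟨w, rfl⟩
      exact ⟨S x w, rfl⟩
    · rintro _ ⟨w, rfl⟩
      refine ⟨(U x + Z x) w, ?_⟩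
      exact congrArg (Y x) (congrArg (fun T : B →L[ℝ] B => T w) (hSW x))
  have hdecay : ∀ {P U : B →L[ℝ] B}, (∀ w, ‖U w - P w‖ ≤ 2 * C * θ * ‖P w‖) → ∀ (n : ℕ) (w : B),
      2 * C * lam₁ ^ n * ‖P w‖ ≤ (4 * C + 2) * lam₁ ^ n * ‖U w‖ := fun {P U} hU n w =>
    calc _ ≤ 2 * C * lam₁ ^ n * (2 * ‖U w‖) := by gcongr; exact hlarge hU w
      _ = 4 * C * lam₁ ^ n * ‖U w‖ := by ring
      _ ≤ _ := by gcongr; linarith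
  refine ⟨fun x => U x ∘L S x, fun x => Z x ∘L S x, fun x => ?_, fun x => hbd (hP x) (hUn x) (hS x),
    fun x => hbd (hQ x) (hZn x) (hS x), fun x => ?_, fun x => ?_, fun x n v hv => ?_,
    fun x n v hv => ?_⟩
  · rw [← ContinuousLinearMap.add_comp, hWS]
  · rw [hrange, hrange]; exact hUi x
  · rw [hrange, hrange]; exact hZi x
  · rw [hrange] at hv
    obtain ⟨w, rfl⟩ := hv
    exact (hUd x n w).trans (hdecay (hU x) n w)
  · rw [hrange] at hv
    obtain ⟨w, rfl⟩ := hv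
    exact (hZd x n w).trans (hdecay (hZ x) n w)

theorem IsC1Diffeo.comp_deriv_inv {f fInv : B → B} {Df DfInv : B → B →L[ℝ] B}
    (hf : IsC1Diffeo f fInv Df DfInv) (x : B) :
    Df x ∘L DfInv (f x) = ContinuousLinearMap.id ℝ B := by
  obtain ⟨hl, hr, hd, hd'⟩ := hf
  have h1 : HasFDerivAt (f ∘ fInv) (Df x ∘L DfInv (f x)) (f x) :=
    HasFDerivAt.comp (f x) (by rw [hl x]; exact hd x) (hd' (f x))
  rw [hr.comp_eq_id] at h1
  exact h1.unique (hasFDerivAt_id _)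

theorem IsC1Diffeo.deriv_inv_comp {f fInv : B → B} {Df DfInv : B → B →L[ℝ] B}
    (hf : IsC1Diffeo f fInv Df DfInv) (x : B) :
    DfInv (f x) ∘L Df x = ContinuousLinearMap.id ℝ B := by
  obtain ⟨hl, hr, hd, hd'⟩ := hf
  have h1 : HasFDerivAt (fInv ∘ f) (DfInv (f x) ∘L Df x) x := (hd' (f x)).comp x (hd x)
  rw [hl.comp_eq_id] at h1
  exact h1.unique (hasFDerivAt_id _)

/-- Inverses of nearby operators are close. -/
theorem norm_inverse_sub_inverse_le {A A' S S' : B →L[ℝ] B} {R η : ℝ}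
    (hA : A ∘L S = ContinuousLinearMap.id ℝ B) (hS' : S' ∘L A' = ContinuousLinearMap.id ℝ B)
    (hR : ‖S‖ ≤ R) (hη : ‖A' - A‖ ≤ η) (hηR : η * R ≤ 1 / 2) :
    ‖S' - S‖ ≤ 2 * R ^ 2 * η := by
  have hη0 := (norm_nonneg _).trans hη
  have hR0 := (norm_nonneg _).trans hR
  have key : S' - S = -(S' ∘L (A' - A) ∘L S) := by
    rw [ContinuousLinearMap.sub_comp, ContinuousLinearMap.comp_sub,
      ← ContinuousLinearMap.comp_assoc, hS', hA, ContinuousLinearMap.id_comp,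
      ContinuousLinearMap.comp_id, neg_sub]
  have h1 : ‖S' - S‖ ≤ ‖S'‖ * (η * R) := by
    rw [key, norm_neg]
    refine (ContinuousLinearMap.opNorm_comp_le _ _).trans ?_
    gcongr
    exact (ContinuousLinearMap.opNorm_comp_le _ _).trans (by gcongr)
  have h2 : ‖S'‖ ≤ 2 * R := by
    have := norm_le_norm_sub_add S' S
    have : ‖S'‖ * (η * R) ≤ ‖S'‖ * (1 / 2) := by gcongr
    linarith
  calc _ ≤ ‖S'‖ * (η * R) := h1
    _ ≤ 2 * R * (η * R) := by gcongr
    _ = _ := by ring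

theorem C1Reg.exists_norm_deriv_sub_le {f : B → B} {Df DfInv : B → B →L[ℝ] B} {R : ℝ} {r : ℝ → ℝ}
    (h : C1Reg f Df DfInv R r) {ε : ℝ} (hε : 0 < ε) :
    ∃ d > 0, ∀ x y, ‖x - y‖ ≤ d → ‖Df x - Df y‖ ≤ ε := by
  obtain ⟨-, -, -, hr, -, -, -, hD⟩ := h
  have h1 := hr.eventually (gt_mem_nhds hε)
  rw [eventually_nhdsWithin_iff, Metric.eventually_nhds_iff] at h1
  obtain ⟨d, hd, h2⟩ := h1
  refine ⟨d / 2, half_pos hd, fun x y hxy => ?_⟩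
  rcases eq_or_ne x y with rfl | hne
  · simpa using hε.le
  · have h3 := hD y (x - y)
    rw [add_sub_cancel] at h3
    refine h3.trans (h2 ?_ (norm_pos_iff.2 (sub_ne_zero.2 hne))).le
    rw [Real.dist_0_eq_abs, abs_norm]
    linarith

theorem norm_iterate_sub_iterate_le {f g : B → B} {R δ : ℝ} (hR : 0 ≤ R) (hδ : 0 ≤ δ)
    (hf : ∀ x y, ‖f x - f y‖ ≤ R * ‖x - y‖) (hg : ∀ x, ‖g x - f x‖ ≤ δ) (z : B) (n : ℕ) :
    ‖f^[n] z - g^[n] z‖ ≤ δ * (1 + R) ^ n := by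
  induction n with
  | zero => simpa using hδ
  | succ n ih =>
    rw [Function.iterate_succ_apply', Function.iterate_succ_apply']
    have h1 := norm_sub_le_norm_sub_add_norm_sub (f (f^[n] z)) (f (g^[n] z)) (g (g^[n] z))
    have h2 := hg (g^[n] z)
    rw [norm_sub_rev] at h2
    have h3 := hf (f^[n] z) (g^[n] z)
    have h4 : R * ‖f^[n] z - g^[n] z‖ ≤ R * (δ * (1 + R) ^ n) := by gcongr
    have h5 : δ * 1 ≤ δ * (1 + R) ^ n := by gcongr; exact one_le_pow₀ (by linarith)
    calc _ ≤ R * (δ * (1 + R) ^ n) + δ * (1 + R) ^ n := by linarith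
      _ = _ := by ring

section Shadowing

variable (f g fInv gInv : B → B) (Df DfInv P Q : B → B →L[ℝ] B) (N : ℕ)

/-- The Green solution on the window `[0, N]` along the `f`-orbit of `z`, with forcing read
along the `g`-orbit of `z`. -/
def windowSol (w : B → B) (z : B) (n : ℕ) : B :=
  ∑ i ∈ Finset.range N, green f fInv Df DfInv P Q z n (i + 1) (w (g^[i + 1] z))

/-- The average of the window solutions over all positions in the window. -/
def windowAvg (w : B → B) (x : B) : B :=
  (N : ℝ)⁻¹ • ∑ j ∈ Finset.range N,
    windowSol f g fInv Df DfInv P Q N w (gInv^[j + 1] x) (j + 1)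

variable {f g fInv gInv Df DfInv P Q N} {C lam : ℝ}

theorem windowAvg_sub (w w' : B → B) (x : B) :
    windowAvg f g fInv gInv Df DfInv P Q N (fun y => w y - w' y) x =
      windowAvg f g fInv gInv Df DfInv P Q N w x - windowAvg f g fInv gInv Df DfInv P Q N w' x := by
  simp only [windowAvg, windowSol, map_sub, Finset.sum_sub_distrib, smul_sub]

theorem windowSol_succ (hl : Function.LeftInverse fInv f)
    (hPQ : ∀ x, P x + Q x = ContinuousLinearMap.id ℝ B)
    (hD : ∀ x, Df x ∘L DfInv (f x) = ContinuousLinearMap.id ℝ B) (w : B → B) (z : B) {n : ℕ}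
    (hn : n < N) :
    windowSol f g fInv Df DfInv P Q N w z (n + 1) =
      Df (f^[n] z) (windowSol f g fInv Df DfInv P Q N w z n) + w (g^[n + 1] z) := by
  have hterm : ∀ i, green f fInv Df DfInv P Q z (n + 1) (i + 1) (w (g^[i + 1] z)) =
      Df (f^[n] z) (green f fInv Df DfInv P Q z n (i + 1) (w (g^[i + 1] z))) +
        if i = n then w (g^[n + 1] z) else 0 := fun i => by
    rw [green_succ hl hPQ hD]
    by_cases hi : i = n
    · subst hi; simp
    · simp [hi]
  rw [windowSol, Finset.sum_congr rfl fun i _ => hterm i, Finset.sum_add_distrib, ← map_sum,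
    Finset.sum_ite_eq' _ n, if_pos (Finset.mem_range.2 hn), windowSol]

theorem norm_windowSol_le (hlam0 : 0 ≤ lam) (hlam1 : lam < 1) (hC : 0 ≤ C)
    (hCL : IsGenCL f fInv Df DfInv C lam P Q) {w : B → B} {a : ℝ} (ha : 0 ≤ a)
    (hw : ∀ x, ‖w x‖ ≤ a) (z : B) (n : ℕ) :
    ‖windowSol f g fInv Df DfInv P Q N w z n‖ ≤ C ^ 2 * (2 / (1 - lam)) * a :=
  calc _ ≤ ∑ i ∈ Finset.range N, C ^ 2 * a * (expKernel lam n i * 1 ^ i) :=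
        norm_sum_le_of_le _ fun i _ =>
          calc _ ≤ C ^ 2 * expKernel lam n i * a :=
                ContinuousLinearMap.le_of_opNorm_le_of_le _
                  (norm_green_le hlam0 hC hCL z n i) (hw _)
            _ = _ := by ring
    _ = C ^ 2 * a * ∑ i ∈ Finset.range N, expKernel lam n i * 1 ^ i := by rw [Finset.mul_sum]
    _ ≤ C ^ 2 * a * ((1 / (1 - lam) + 1 / (1 - lam)) * 1 ^ n) := by
        gcongr; exact sum_expKernel_le hlam0 hlam1 le_rfl n N
    _ = _ := by rw [one_pow]; ring

theorem norm_windowAvg_le (hlam0 : 0 ≤ lam) (hlam1 : lam < 1) (hC : 0 ≤ C) (hN : 0 < N)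
    (hCL : IsGenCL f fInv Df DfInv C lam P Q) {w : B → B} {a : ℝ} (ha : 0 ≤ a)
    (hw : ∀ x, ‖w x‖ ≤ a) (x : B) :
    ‖windowAvg f g fInv gInv Df DfInv P Q N w x‖ ≤ C ^ 2 * (2 / (1 - lam)) * a := by
  have hN' : (0 : ℝ) < N := Nat.cast_pos.2 hN
  rw [windowAvg, norm_smul, norm_inv, Real.norm_natCast, inv_mul_le_iff₀ hN']
  refine (norm_sum_le_of_le _ fun j _ =>
    norm_windowSol_le hlam0 hlam1 hC hCL ha hw (gInv^[j + 1] x) (j + 1)).trans ?_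
  rw [Finset.sum_const, Finset.card_range, nsmul_eq_mul]

/-- The averaged window solution is an approximate right inverse of the difference operator
`v ↦ v - (Df ∘ gInv) (v ∘ gInv)`. -/
theorem norm_windowAvg_error_le (hlam0 : 0 ≤ lam) (hlam1 : lam < 1) (hC : 0 ≤ C) (hN : 0 < N)
    (hl : Function.LeftInverse fInv f) (hr : Function.RightInverse gInv g)
    (hD : ∀ x, Df x ∘L DfInv (f x) = ContinuousLinearMap.id ℝ B)
    (hCL : IsGenCL f fInv Df DfInv C lam P Q) {R ε : ℝ} (hR : ∀ x, ‖Df x‖ ≤ R)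
    (hε : ∀ z, ∀ j < N, ‖Df (f^[j] z) - Df (g^[j] z)‖ ≤ ε)
    {w : B → B} {a : ℝ} (ha : 0 ≤ a) (hw : ∀ x, ‖w x‖ ≤ a) (x : B) :
    ‖windowAvg f g fInv gInv Df DfInv P Q N w x -
        Df (gInv x) (windowAvg f g fInv gInv Df DfInv P Q N w (gInv x)) - w x‖ ≤
      (ε + 2 * R / N) * (C ^ 2 * (2 / (1 - lam)) * a) := by
  have hN' : (0 : ℝ) < N := Nat.cast_pos.2 hN
  set κ := C ^ 2 * (2 / (1 - lam)) * a
  set u := windowSol f g fInv Df DfInv P Q N w with hu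
  have hub : ∀ z n, ‖u z n‖ ≤ κ := norm_windowSol_le hlam0 hlam1 hC hCL ha hw
  set b : ℕ → B := fun j => Df (gInv x) (u (gInv^[j + 1] x) j) with hb
  have hbb : ∀ j, ‖b j‖ ≤ R * κ := fun j =>
    ContinuousLinearMap.le_of_opNorm_le_of_le _ (hR _) (hub _ _)
  have hbracket : ∀ j ∈ Finset.range N,
      ‖u (gInv^[j + 1] x) (j + 1) - w x - b j‖ ≤ ε * κ := fun j hj => by
    have hj := Finset.mem_range.1 hj
    have hgz : g^[j] (gInv^[j + 1] x) = gInv x := by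
      rw [Function.iterate_succ_apply, hr.iterate j]
    have hgz' : g^[j + 1] (gInv^[j + 1] x) = x := hr.iterate (j + 1) x
    have := hε (gInv^[j + 1] x) j hj
    rw [hgz] at this
    rw [hu, windowSol_succ hl hCL.1 hD w _ hj, hgz', add_sub_cancel_right, hb, ← sub_apply]
    exact ContinuousLinearMap.le_of_opNorm_le_of_le _ this (hub _ _)
  have hkey : windowAvg f g fInv gInv Df DfInv P Q N w x -
        Df (gInv x) (windowAvg f g fInv gInv Df DfInv P Q N w (gInv x)) - w x =
      (N : ℝ)⁻¹ • (∑ j ∈ Finset.range N, (u (gInv^[j + 1] x) (j + 1) - w x - b j) +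
        (b 0 - b N)) := by
    rw [← Finset.sum_range_sub', ← Finset.sum_add_distrib, windowAvg, windowAvg, map_smul, map_sum,
      ← smul_sub, ← Finset.sum_sub_distrib]
    have hwx : w x = (N : ℝ)⁻¹ • ∑ j ∈ Finset.range N, w x := by
      rw [Finset.sum_const, Finset.card_range, ← Nat.cast_smul_eq_nsmul ℝ, smul_smul,
        inv_mul_cancel₀ hN'.ne', one_smul]
    conv_lhs => rw [hwx]
    rw [← smul_sub, ← Finset.sum_sub_distrib]
    congr 1
    refine Finset.sum_congr rfl fun j _ => ?_
    simp only [hb, hu, Function.iterate_succ_apply]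
    abel
  rw [hkey, norm_smul, norm_inv, Real.norm_natCast, inv_mul_le_iff₀ hN']
  refine (norm_add_le_of_le (norm_sum_le_of_le _ hbracket)
    (norm_sub_le_of_le (hbb 0) (hbb N))).trans (le_of_eq ?_)
  rw [Finset.sum_const, Finset.card_range, nsmul_eq_mul]
  field_simp
  ring

end Shadowing

theorem IsGenCL.comp_semiconj {f fInv g gInv h : B → B} {Df DfInv P Q : B → B →L[ℝ] B} {C lam : ℝ}
    (hCL : IsGenCL f fInv Df DfInv C lam P Q) (hf : Function.LeftInverse fInv f)
    (hg : Function.RightInverse gInv g) (hsc : Function.Semiconj h g f) :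
    IsGenCL g gInv (fun x => Df (h x)) (fun x => DfInv (h x)) C lam
      (fun x => P (h x)) (fun x => Q (h x)) := by
  have hsc' : Function.Semiconj h gInv fInv := hsc.inverses_right hg hf
  obtain ⟨hPQ, hP, hQ, hPi, hQi, hs, hu⟩ := hCL
  refine ⟨fun x => hPQ _, fun x => hP _, fun x => hQ _, fun x => ?_, fun x => ?_,
    fun x n v hv => ?_, fun x n v hv => ?_⟩
  · beta_reduce; rw [hsc]; exact hPi (h x)
  · beta_reduce; rw [hsc']; exact hQi (h x)
  · rw [orbitDeriv_semiconj hsc]; exact hs _ _ _ hv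
  · rw [orbitDeriv_semiconj hsc']; exact hu _ _ _ hv

/-- Every sufficiently small `C⁰` perturbation of `f` is semiconjugate to `f` by a map close to
the identity, which need not be continuous. -/
theorem IsGenCL.exists_semiconj {f fInv : B → B} {Df DfInv P Q : B → B →L[ℝ] B} {C lam R : ℝ}
    {r : ℝ → ℝ} (hCL : IsGenCL f fInv Df DfInv C lam P Q) (hC : 0 < C) (hlam0 : 0 ≤ lam)
    (hlam1 : lam < 1) (hf : IsC1Diffeo f fInv Df DfInv) (hreg : C1Reg f Df DfInv R r)
    {ε₀ : ℝ} (hε₀ : 0 < ε₀) :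
    ∃ δ > 0, ∀ g gInv : B → B, Function.LeftInverse gInv g →
      Function.RightInverse gInv g → (∀ x, ‖g x - f x‖ ≤ δ) →
      ∃ h : B → B, (∀ x, ‖h x - x‖ ≤ ε₀) ∧ Function.Semiconj h g f := by
  have hlam2 : 0 < 1 - lam := sub_pos.2 hlam1
  have hR := hreg.1
  have hDR := hreg.2.2.2.2.2.1
  set K : ℝ := C ^ 2 * (2 / (1 - lam)) with hK
  have hK0 : 0 < K := by positivity
  obtain ⟨d, hd, hDf⟩ := hreg.exists_norm_deriv_sub_le (ε := 1 / (4 * K)) (by positivity)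
  obtain ⟨N, hN⟩ := exists_nat_gt (8 * R * K)
  have hN0' : (0 : ℝ) < N := lt_trans (by positivity) hN
  have hN0 : 0 < N := Nat.cast_pos.1 hN0'
  set ρ : ℝ := min d ε₀ / K with hρ
  have hρ0 : 0 < ρ := div_pos (lt_min hd hε₀) hK0
  have hKρ : K * ρ = min d ε₀ := mul_div_cancel₀ _ hK0.ne'
  have hfac : (1 / (4 * K) + 2 * R / N) * K ≤ 1 / 2 := by
    have h1 : 2 * R / N * K ≤ 1 / 4 := by
      rw [div_mul_eq_mul_div, div_le_iff₀ hN0']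
      linarith
    have h2 : 1 / (4 * K) * K = 1 / 4 := by field_simp
    linarith
  have hfR : ∀ x y, ‖f x - f y‖ ≤ R * ‖x - y‖ := fun x y =>
    convex_univ.norm_image_sub_le_of_norm_hasFDerivWithin_le
      (fun z _ => (hf.2.2.1 z).hasFDerivWithinAt) (fun z _ => hDR z) (mem_univ y) (mem_univ x)
  refine ⟨min (d / (1 + R) ^ N) (ρ / 4), by positivity, fun g gInv hg' hg hclose => ?_⟩
  have hδ1 : ∀ z, ∀ j < N, ‖Df (f^[j] z) - Df (g^[j] z)‖ ≤ 1 / (4 * K) := fun z j hj => by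
    refine hDf _ _ ((norm_iterate_sub_iterate_le hR.le (by positivity) hfR hclose z j).trans ?_)
    calc _ ≤ d / (1 + R) ^ N * (1 + R) ^ N := by
          gcongr
          · exact min_le_left _ _
          · linarith
      _ = d := div_mul_cancel₀ _ (by positivity)
  set S : (B → B) → B → B := windowAvg f g fInv gInv Df DfInv P Q N with hS
  have hSle : ∀ {w : B → B} {a : ℝ}, 0 ≤ a → (∀ x, ‖w x‖ ≤ a) → ∀ x, ‖S w x‖ ≤ K * a :=
    fun ha hw x => norm_windowAvg_le hlam0 hlam1 hC.le hN0 hCL ha hw x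
  obtain ⟨w, hw, hfix⟩ := exists_fixed_family
    (fun (w : B → B) x => w x - S w x + f (gInv x + S w (gInv x)) - x) (fun _ => 1)
    (fun _ => zero_le_one) (q := 3 / 4) (ρ := ρ) (by norm_num) (by norm_num) hρ0.le
    (fun w w' a ha hw hw' hww' x => by
      simp only [mul_one] at hw hw' hww' ⊢
      set z := gInv x
      have hsub : ∀ y, S (fun y => w y - w' y) y = S w y - S w' y := windowAvg_sub w w'
      have herr := norm_windowAvg_error_le hlam0 hlam1 hC.le hN0 hf.1 hg hf.comp_deriv_inv hCL hDR
        hδ1 ha hww' x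
      rw [← hS, ← hK, hsub, hsub, ← mul_assoc] at herr
      have hball : ∀ {v : B → B}, (∀ x, ‖v x‖ ≤ ρ) → z + S v z ∈ Metric.closedBall z d :=
        fun hv => by
          rw [mem_closedBall_iff_norm, add_sub_cancel_left]
          exact (hSle hρ0.le hv z).trans (hKρ.le.trans (min_le_left _ _))
      have hmv := (convex_closedBall z d).norm_image_sub_le_of_norm_hasFDerivWithin_le'
        (fun y _ => (hf.2.2.1 y).hasFDerivWithinAt)
        (fun y hy => hDf y z (mem_closedBall_iff_norm.1 hy)) (hball hw') (hball hw)
      rw [add_sub_add_left_eq_sub] at hmv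
      have hD := hSle ha hww' z
      rw [hsub] at hD
      have hmv' : 1 / (4 * K) * ‖S w z - S w' z‖ ≤ a / 4 :=
        calc _ ≤ 1 / (4 * K) * (K * a) := by gcongr
          _ = a / 4 := by field_simp
      have herr' : (1 / (4 * K) + 2 * R / N) * K * a ≤ 1 / 2 * a := by gcongr
      calc _ = ‖(f (z + S w z) - f (z + S w' z) - Df z (S w z - S w' z)) -
              (S w x - S w' x - Df z (S w z - S w' z) - (w x - w' x))‖ := by congr 1; abel
        _ ≤ _ := norm_sub_le _ _
        _ ≤ 3 / 4 * a := by linarith)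
    (fun x => by
      have hS0 : ∀ y, S 0 y = 0 := fun y => by
        have := hSle (w := 0) le_rfl (fun _ => by simp) y
        simpa using this
      have h1 := hclose (gInv x)
      rw [hg x, norm_sub_rev] at h1
      simp only [hS0, Pi.zero_apply, sub_zero, add_zero, zero_add]
      exact h1.trans ((min_le_right _ _).trans (by linarith)))
  simp only [mul_one] at hw
  have hfix' : ∀ x, x + S w x = f (gInv x + S w (gInv x)) := fun x => by
    have h1 : w x - S w x + f (gInv x + S w (gInv x)) - x = w x := congrFun hfix x
    rw [sub_eq_iff_eq_add, sub_add_eq_add_sub, sub_eq_iff_eq_add, add_assoc] at h1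
    exact (add_left_cancel h1).symm
  refine ⟨fun x => x + S w x, fun x => ?_, fun x => ?_⟩
  · rw [add_sub_cancel_left]
    exact (hSle hρ0.le hw x).trans (hKρ.le.trans (min_le_right _ _))
  · beta_reduce
    rw [hfix', hg' x]

/-- Robustness of the generalized `(C, λ)`-structure: for a `C¹`
diffeomorphism `f` of a reflexive Banach space satisfying the `C¹` regularity conditions
and a generalized `(C, λ)`-structure, and any `λ₁ ∈ (λ, 1)`, there are `δ > 0`, `C₁ > 0`
such that every `C¹` diffeomorphism `g` with `‖g − f‖_{C¹} < δ` satisfies a generalized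
`(C₁, λ₁)`-structure. -/
theorem statement13
    {B : Type*} [NormedAddCommGroup B] [NormedSpace ℝ B] [CompleteSpace B]
    (hrefl : Function.Surjective (NormedSpace.inclusionInDoubleDual ℝ B))
    (f fInv : B → B) (Df DfInv : B → B →L[ℝ] B) (R : ℝ) (r : ℝ → ℝ)
    (hf : IsC1Diffeo f fInv Df DfInv) (hreg : C1Reg f Df DfInv R r)
    (C lam : ℝ) (hC : 0 < C) (hlam : lam ∈ Set.Ioo (0 : ℝ) 1)
    (P Q : B → B →L[ℝ] B) (hCL : IsGenCL f fInv Df DfInv C lam P Q) :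
    ∀ lam₁ ∈ Set.Ioo lam 1, ∃ δ : ℝ, 0 < δ ∧ ∃ C₁ : ℝ, 0 < C₁ ∧
      ∀ (g gInv : B → B) (Dg DgInv : B → B →L[ℝ] B),
        IsC1Diffeo g gInv Dg DgInv →
        (∀ x, ‖g x - f x‖ + ‖Dg x - Df x‖ < δ) →
        ∃ P' Q' : B → B →L[ℝ] B, IsGenCL g gInv Dg DgInv C₁ lam₁ P' Q' := by
  rintro lam₁ ⟨h1, h2⟩
  have hlam1 : 0 < lam₁ - lam := sub_pos.2 h1
  have hlam2 : 0 < 1 - lam := sub_pos.2 hlam.2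
  have hR := hreg.1
  set θ : ℝ := 1 / (2 + 4 * C + 8 * C ^ 2) with hθ
  set G : ℝ := C ^ 2 * (1 / (lam₁ - lam) + 1 / (1 - lam)) with hG
  have hθ0 : 0 < θ := by positivity
  have hG0 : 0 < G := by positivity
  set η : ℝ := θ / G with hη
  have hη0 : 0 < η := by positivity
  set η' : ℝ := min η (min (1 / 2 / R) (η / (2 * R ^ 2))) with hη'
  have hη'0 : 0 < η' := by positivity
  have hη'R : η' * R ≤ 1 / 2 :=
    (le_div_iff₀ hR).1 ((min_le_right _ _).trans (min_le_left _ _))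
  have hη'2 : 2 * R ^ 2 * η' ≤ η :=
    (le_div_iff₀' (by positivity)).1 ((min_le_right _ _).trans (min_le_right _ _))
  obtain ⟨d, hd, hDf⟩ := hreg.exists_norm_deriv_sub_le (half_pos hη'0)
  obtain ⟨δ₀, hδ₀, hsemi⟩ := hCL.exists_semiconj hC hlam.1.le hlam.2 hf hreg hd
  refine ⟨min δ₀ (η' / 2), lt_min hδ₀ (half_pos hη'0), 4 * C + 2, by positivity,
    fun g gInv Dg DgInv hg hclose => ?_⟩
  have hgf : ∀ x, ‖g x - f x‖ ≤ δ₀ := fun x => by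
    linarith [hclose x, norm_nonneg (Dg x - Df x), min_le_left δ₀ (η' / 2)]
  obtain ⟨h, hh, hsc⟩ := hsemi g gInv hg.1 hg.2.1 hgf
  have hDg : ∀ x, ‖Dg x - Df (h x)‖ ≤ η' := fun x => by
    have := norm_sub_le_norm_sub_add_norm_sub (Dg x) (Df x) (Df (h x))
    have := hDf x (h x) (by rw [norm_sub_rev]; exact hh x)
    linarith [hclose x, norm_nonneg (g x - f x), min_le_right δ₀ (η' / 2)]
  have hDgInv : ∀ y, ‖DgInv y - DfInv (h y)‖ ≤ η := fun y => by
    have hS' := hg.deriv_inv_comp (gInv y)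
    have hS := hf.comp_deriv_inv (h (gInv y))
    rw [hg.2.1 y] at hS'
    rw [← hsc, hg.2.1 y] at hS
    exact (norm_inverse_sub_inverse_le hS hS' (hreg.2.2.2.2.2.2.1 _) (hDg _) hη'R).trans hη'2
  refine IsGenCL.exists_perturbed (A := fun x => Df (h x)) (Ainv := fun x => DfInv (h x))
    (η := η) (θ := θ) hC hlam.1 h1 h2 hη0.le ?_ ?_ hg.1 hg.2.1 (fun x => ?_) (fun x => ?_)
    (fun x => (hDg x).trans (min_le_left _ _)) hDgInv
    (hCL.comp_semiconj hf.1 hg.2.1 hsc)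
  · refine le_of_eq ?_
    rw [show C ^ 2 * η * (1 / (lam₁ - lam) + 1 / (1 - lam)) = η * G by rw [hG]; ring, hη,
      div_mul_cancel₀ _ hG0.ne']
  · rw [hθ, one_div, inv_mul_cancel₀ (by positivity)]
  · rw [hsc]; exact hf.comp_deriv_inv (h x)
  · rw [hsc]; exact hf.deriv_inv_comp (h x)

end
end

section
/- Let B be a Banach space and f : B → B a C¹ diffeomorphism satisfying the C¹ regularity conditions and a uniformly continuous generalized (C,λ)-structure. Then there exist M > 0 and d₀ > 0 such that for any d ∈ (0,d₀) and any C¹ diffeomorphism g : B → B with ‖f − g‖_{C¹} < d there exist continuous maps h₁, h₂ : B → B satisfying g ∘ (Id + h₁) = (Id + h₁) ∘ f, f ∘ (Id + h₂) = (Id + h₂) ∘ g, and |h₁(x)| < Md, |h₂(x)| < Md for all x ∈ B. -/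
open Set Filter

noncomputable section

variable {B : Type*} [NormedAddCommGroup B] [NormedSpace ℝ B] [CompleteSpace B]

open scoped BoundedContinuousFunction

/-- The weighted composition operator `w ↦ (x ↦ D (σ x) (w (σ x)))` on bounded continuous
functions. -/
def weightedComp (σ : B → B) (D : B → B →L[ℝ] B) {K : ℝ} (hσ : Continuous σ)
    (hD : Continuous D) (hK : ∀ x, ‖D x‖ ≤ K) : (B →ᵇ B) →L[ℝ] (B →ᵇ B) :=
  LinearMap.mkContinuous
    { toFun := fun w => BoundedContinuousFunction.ofNormedAddCommGroup
        (fun x => D (σ x) (w (σ x))) (by fun_prop) (K * ‖w‖)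
        (fun x => ContinuousLinearMap.le_of_opNorm_le_of_le _ (hK (σ x)) (w.norm_coe_le_norm _))
      map_add' := fun w w' => by ext x; simp
      map_smul' := fun c w => by ext x; simp }
    K (fun w => BoundedContinuousFunction.norm_ofNormedAddCommGroup_le _
      (mul_nonneg ((norm_nonneg _).trans (hK 0)) (norm_nonneg _))
      (fun x => ContinuousLinearMap.le_of_opNorm_le_of_le _ (hK (σ x)) (w.norm_coe_le_norm _)))

section weightedComp

variable {σ : B → B} {D : B → B →L[ℝ] B} {K : ℝ} (hσ : Continuous σ)
  (hD : Continuous D) (hK : ∀ x, ‖D x‖ ≤ K)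

omit [CompleteSpace B] in
@[simp]
lemma weightedComp_apply (w : B →ᵇ B) (x : B) :
    weightedComp σ D hσ hD hK w x = D (σ x) (w (σ x)) := rfl

omit [CompleteSpace B] in
lemma norm_weightedComp_le : ‖weightedComp σ D hσ hD hK‖ ≤ K :=
  LinearMap.mkContinuous_norm_le _ ((norm_nonneg _).trans (hK 0)) _

omit [CompleteSpace B] in
lemma weightedComp_pow_apply {θ : B → B} (hθ : Function.LeftInverse θ σ) (n : ℕ)
    (w : B →ᵇ B) (x : B) :
    (weightedComp σ D hσ hD hK ^ n) w x = orbitDeriv θ D n (σ^[n] x) (w (σ^[n] x)) := by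
  induction n generalizing w with
  | zero => simp [orbitDeriv]
  | succ n ih =>
    rw [pow_succ, mul_apply_eq_comp, ih, weightedComp_apply,
      Function.iterate_succ_apply', orbitDeriv, ContinuousLinearMap.comp_apply, hθ]

omit [CompleteSpace B] in
lemma norm_weightedComp_pow_mul_le {θ : B → B} (hθ : Function.LeftInverse θ σ) (n : ℕ)
    {P : B → B →L[ℝ] B} {C η : ℝ} (hP : Continuous P) (hPC : ∀ x, ‖P x‖ ≤ C) (hη : 0 ≤ η)
    (h : ∀ x v, ‖orbitDeriv θ D n x (P x v)‖ ≤ η * ‖v‖) :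
    ‖weightedComp σ D hσ hD hK ^ n * weightedComp id P continuous_id hP hPC‖ ≤ η := by
  refine ContinuousLinearMap.opNorm_le_bound _ hη fun w => ?_
  refine (BoundedContinuousFunction.norm_le (by positivity)).2 fun x => ?_
  rw [mul_apply_eq_comp, weightedComp_pow_apply hσ hD hK hθ]
  exact (h _ _).trans (by gcongr; exact w.norm_coe_le_norm _)

end weightedComp

omit [CompleteSpace B] in
/-- The orbit derivative inherits boundedness from the one-step derivative. -/
lemma norm_orbitDeriv_le {F : B → B} {DF : B → B →L[ℝ] B} {R : ℝ} (hR : ∀ x, ‖DF x‖ ≤ R)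
    (n : ℕ) (x : B) : ‖orbitDeriv F DF n x‖ ≤ R ^ n := by
  have hR0 : 0 ≤ R := (norm_nonneg _).trans (hR x)
  induction n generalizing x with
  | zero => simpa [orbitDeriv] using ContinuousLinearMap.norm_id_le
  | succ n ih =>
    rw [orbitDeriv, pow_succ]
    exact (ContinuousLinearMap.opNorm_comp_le _ _).trans
      (mul_le_mul (ih _) (hR x) (norm_nonneg _) (by positivity))

omit [CompleteSpace B] in
/-- The orbit derivatives of a system are uniformly close to those of a nearby system,
over any fixed time. -/
lemma exists_norm_orbitDeriv_sub_le {F : B → B} {DF : B → B →L[ℝ] B} {R : ℝ}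
    (hF : UniformContinuous F) (hDF : UniformContinuous DF) (hR : ∀ x, ‖DF x‖ ≤ R) (n : ℕ) :
    ∀ ε > 0, ∃ δ > 0, ∀ (G : B → B) (DG : B → B →L[ℝ] B) (x y : B), (∀ x, ‖DG x‖ ≤ R) →
      (∀ x, ‖F x - G x‖ ≤ δ) → (∀ x, ‖DF x - DG x‖ ≤ δ) → ‖x - y‖ ≤ δ →
        ‖orbitDeriv F DF n x - orbitDeriv G DG n y‖ ≤ ε := by
  have hR0 : 0 ≤ R := (norm_nonneg _).trans (hR 0)
  induction n with
  | zero =>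
    intro ε hε
    exact ⟨1, one_pos, fun G DG x y _ _ _ _ => by simpa [orbitDeriv] using hε.le⟩
  | succ n ih =>
    intro ε hε
    have hRn : 0 ≤ R ^ n := pow_nonneg hR0 n
    obtain ⟨δ₁, hδ₁, h₁⟩ := ih (ε / (2 * (R + 1))) (by positivity)
    obtain ⟨δ₂, hδ₂, h₂⟩ := Metric.uniformContinuous_iff.1 hF (δ₁ / 2) (by positivity)
    have hη : 0 < ε / (4 * (R ^ n + 1)) := by positivity
    obtain ⟨δ₃, hδ₃, h₃⟩ := Metric.uniformContinuous_iff.1 hDF _ hη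
    refine ⟨min (min (δ₁ / 2) (δ₂ / 2)) (min (δ₃ / 2) (ε / (4 * (R ^ n + 1)))),
      by positivity, fun G DG x y hG hFG hDFG hxy => ?_⟩
    simp only [le_min_iff] at hFG hDFG hxy
    have hFxy : ‖F x - G y‖ ≤ δ₁ := by
      have h := h₂ (a := x) (b := y) (by rw [dist_eq_norm]; linarith [hxy.1.2])
      rw [dist_eq_norm] at h
      linarith [norm_sub_le_norm_sub_add_norm_sub (F x) (F y) (G y), (hFG y).1.1]
    have hDxy : ‖DF x - DG y‖ ≤ ε / (2 * (R ^ n + 1)) := by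
      have h := h₃ (a := x) (b := y) (by rw [dist_eq_norm]; linarith [hxy.2.1])
      rw [dist_eq_norm] at h
      have : ε / (2 * (R ^ n + 1)) = ε / (4 * (R ^ n + 1)) + ε / (4 * (R ^ n + 1)) := by
        field_simp; norm_num
      linarith [norm_sub_le_norm_sub_add_norm_sub (DF x) (DF y) (DG y), (hDFG y).2.2]
    have ho := h₁ G DG (F x) (G y) hG (fun z => (hFG z).1.1.trans (by linarith))
      (fun z => (hDFG z).1.1.trans (by linarith)) hFxy
    have hsplit : orbitDeriv F DF (n + 1) x - orbitDeriv G DG (n + 1) y =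
        (orbitDeriv F DF n (F x) - orbitDeriv G DG n (G y)) ∘L DF x +
          orbitDeriv G DG n (G y) ∘L (DF x - DG y) := by
      ext v; simp [orbitDeriv]
    rw [hsplit]
    calc _ ≤ ε / (2 * (R + 1)) * R + R ^ n * (ε / (2 * (R ^ n + 1))) := by
          refine (norm_add_le _ _).trans (add_le_add ?_ ?_)
          · exact (ContinuousLinearMap.opNorm_comp_le _ _).trans
              (mul_le_mul ho (hR x) (norm_nonneg _) (by positivity))
          · exact (ContinuousLinearMap.opNorm_comp_le _ _).trans
              (mul_le_mul (norm_orbitDeriv_le hG n _) hDxy (norm_nonneg _) hRn)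
      _ ≤ ε / 2 + ε / 2 := by
          refine add_le_add ?_ ?_
          · rw [div_mul_eq_mul_div, div_le_div_iff₀ (by positivity) (by positivity)]
            nlinarith
          · rw [mul_div_assoc', div_le_div_iff₀ (by positivity) (by positivity)]
            nlinarith
      _ = ε := by ring

/-- If `S` is an approximate right inverse of `1 - A`, then `h = A h + 𝒩 h` has a small solution
for every nonlinearity `𝒩` that is small at `0` and has a small Lipschitz constant. -/
lemma exists_eq_add_of_approx_rightInverse {X : Type*} [NormedAddCommGroup X] [NormedSpace ℝ X]
    [CompleteSpace X] (A S : X →L[ℝ] X) (𝒩 : X → X) {K κ d : ℝ}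
    (hE : ‖1 - (1 - A) * S‖ ≤ 1 / 4) (hS : ‖S‖ ≤ K) (h0 : ‖𝒩 0‖ ≤ d) (hκ : 0 ≤ κ)
    (hκK : κ * K ≤ 1 / 4)
    (hLip : ∀ h h', ‖h‖ ≤ K * (2 * d) → ‖h'‖ ≤ K * (2 * d) → ‖𝒩 h - 𝒩 h'‖ ≤ κ * ‖h - h'‖) :
    ∃ h, ‖h‖ ≤ K * (2 * d) ∧ h = A h + 𝒩 h := by
  have hd : 0 ≤ d := (norm_nonneg _).trans h0
  have hK : 0 ≤ K := (norm_nonneg _).trans hS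
  set E := 1 - (1 - A) * S with hEdef
  let G : X → X := fun w => E w + 𝒩 (S w)
  have hSw : ∀ w ∈ Metric.closedBall (0 : X) (2 * d), ‖S w‖ ≤ K * (2 * d) := fun w hw =>
    S.le_of_opNorm_le_of_le hS (mem_closedBall_zero_iff.1 hw)
  have hG : ∀ w ∈ Metric.closedBall (0 : X) (2 * d), ∀ w' ∈ Metric.closedBall (0 : X) (2 * d),
      ‖G w - G w'‖ ≤ 1 / 2 * ‖w - w'‖ := by
    intro w hw w' hw'
    have h1 : ‖E (w - w')‖ ≤ 1 / 4 * ‖w - w'‖ := E.le_of_opNorm_le hE _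
    have h2 : ‖S (w - w')‖ ≤ K * ‖w - w'‖ := S.le_of_opNorm_le hS _
    have h3 := hLip _ _ (hSw w hw) (hSw w' hw')
    rw [← map_sub] at h3
    have h4 : G w - G w' = E (w - w') + (𝒩 (S w) - 𝒩 (S w')) := by
      simp only [G, map_sub]; abel
    rw [h4]
    refine (norm_add_le _ _).trans ?_
    have h5 : κ * ‖S (w - w')‖ ≤ κ * (K * ‖w - w'‖) := by gcongr
    have h6 : κ * K * ‖w - w'‖ ≤ 1 / 4 * ‖w - w'‖ := by gcongr
    linarith
  have hmaps : MapsTo G (Metric.closedBall 0 (2 * d)) (Metric.closedBall 0 (2 * d)) := by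
    intro w hw
    have hw' := mem_closedBall_zero_iff.1 hw
    have h1 := hG w hw 0 (Metric.mem_closedBall_self (by positivity))
    have h2 : G 0 = 𝒩 0 := by simp [G]
    rw [h2, sub_zero] at h1
    rw [mem_closedBall_zero_iff]
    linarith [norm_le_norm_sub_add (G w) (𝒩 0)]
  have hcontr : ContractingWith (1 / 2) (hmaps.restrict G _ _) := by
    refine ⟨one_half_lt_one,
      LipschitzWith.of_dist_le_mul fun w w' => ?_⟩
    simpa [Subtype.dist_eq, dist_eq_norm] using hG w w.2 w' w'.2
  obtain ⟨w, hw, hfix, -⟩ := hcontr.exists_fixedPoint' Metric.isClosed_closedBall.isComplete hmaps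
    (Metric.mem_closedBall_self (by positivity : (0 : ℝ) ≤ 2 * d)) (edist_ne_top _ _)
  refine ⟨S w, hSw w hw, ?_⟩
  have h1 : w - (S w - A (S w)) + 𝒩 (S w) = w := by
    simpa [G, hEdef, Function.IsFixedPt] using hfix
  have h2 : S w - (A (S w) + 𝒩 (S w)) = 0 := by
    rw [← neg_eq_zero, ← sub_eq_zero.2 h1]
    abel
  exact sub_eq_zero.1 h2

/-- Truncated Green operator identity. -/
lemma one_sub_mul_truncatedGreen {𝓡 : Type*} [Ring 𝓡] {a b p q : 𝓡} (hab : a * b = 1)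
    (hpq : p + q = 1) (n : ℕ) :
    1 - (1 - a) * ((∑ i ∈ Finset.range n, a ^ i) * p -
      b * (∑ i ∈ Finset.range n, b ^ i) * q) = a ^ n * p + b ^ n * q := by
  have h1 : (1 - a) * ∑ i ∈ Finset.range n, a ^ i = 1 - a ^ n := mul_neg_geom_sum a n
  have h2 : (b - 1) * ∑ i ∈ Finset.range n, b ^ i = b ^ n - 1 := mul_geom_sum b n
  have h3 : (1 - a) * b = b - 1 := by rw [sub_mul, hab, one_mul]
  have h4 : (1 - a ^ n) * p - (b ^ n - 1) * q = p + q - (a ^ n * p + b ^ n * q) := by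
    noncomm_ring
  rw [mul_sub, ← mul_assoc, h1, ← mul_assoc, ← mul_assoc, h3, h2, h4, hpq, sub_sub_cancel]

omit [CompleteSpace B] in
/-- Contraction along a subspace family survives, over a fixed time, under perturbations. -/
lemma exists_norm_orbitDeriv_apply_le {F : B → B} {DF P : B → B →L[ℝ] B} {R C lam : ℝ}
    (hF : UniformContinuous F) (hDF : UniformContinuous DF) (hR : ∀ x, ‖DF x‖ ≤ R)
    (hC : 0 < C) (hlam : 0 < lam) (hPC : ∀ x, ‖P x‖ ≤ C)
    (hcontr : ∀ x (n : ℕ) (v : B), v ∈ Set.range (P x) →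
      ‖orbitDeriv F DF n x v‖ ≤ C * lam ^ n * ‖v‖)
    {n : ℕ} (hn : C * lam ^ n * C ≤ 1 / 16) :
    ∃ δ > 0, ∀ (G : B → B) (DG : B → B →L[ℝ] B), (∀ x, ‖DG x‖ ≤ R) →
      (∀ x, ‖F x - G x‖ ≤ δ) → (∀ x, ‖DF x - DG x‖ ≤ δ) →
        ∀ x v, ‖orbitDeriv G DG n x (P x v)‖ ≤ 1 / 8 * ‖v‖ := by
  obtain ⟨δ, hδ, h⟩ := exists_norm_orbitDeriv_sub_le hF hDF hR n (1 / (16 * C)) (by positivity)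
  refine ⟨δ, hδ, fun G DG hG hFG hDFG x v => ?_⟩
  have h1 := hcontr x n (P x v) ⟨v, rfl⟩
  have h2 := (orbitDeriv F DF n x - orbitDeriv G DG n x).le_of_opNorm_le
    (h G DG x x hG hFG hDFG (by simpa using hδ.le)) (P x v)
  have h3 : ‖P x v‖ ≤ C * ‖v‖ := (P x).le_of_opNorm_le (hPC x) v
  have h4 : C * lam ^ n * ‖P x v‖ ≤ 1 / 16 * ‖v‖ :=
    calc C * lam ^ n * ‖P x v‖ ≤ C * lam ^ n * (C * ‖v‖) := by gcongr
      _ = C * lam ^ n * C * ‖v‖ := by ring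
      _ ≤ 1 / 16 * ‖v‖ := by gcongr
  have h5 : 1 / (16 * C) * ‖P x v‖ ≤ 1 / 16 * ‖v‖ :=
    calc 1 / (16 * C) * ‖P x v‖ ≤ 1 / (16 * C) * (C * ‖v‖) := by gcongr
      _ = 1 / 16 * ‖v‖ := by field_simp
  rw [sub_apply] at h2
  linarith [norm_le_norm_add_norm_sub (orbitDeriv F DF n x (P x v))
    (orbitDeriv G DG n x (P x v))]

section Diffeo

variable {f fInv : B → B} {Df DfInv : B → B →L[ℝ] B} {R : ℝ} {r : ℝ → ℝ}

omit [CompleteSpace B] in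
lemma uniformContinuous_of_hasFDerivAt_of_bounded (hf : ∀ x, HasFDerivAt f (Df x) x)
    (hR : ∀ x, ‖Df x‖ ≤ R) : UniformContinuous f :=
  (LipschitzWith.of_dist_le_mul (K := ⟨R, (norm_nonneg _).trans (hR 0)⟩) fun x y => by
    simpa only [dist_eq_norm] using! convex_univ.norm_image_sub_le_of_norm_hasFDerivWithin_le
      (fun z _ => (hf z).hasFDerivWithinAt) (fun z _ => hR z) (mem_univ y)
      (mem_univ x)).uniformContinuous

omit [CompleteSpace B] in
lemma IsC1Diffeo.symm (hf : IsC1Diffeo f fInv Df DfInv) : IsC1Diffeo fInv f DfInv Df :=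
  ⟨hf.2.1, hf.1, hf.2.2.2, hf.2.2.1⟩

omit [CompleteSpace B] in
lemma IsC1Diffeo.deriv_comp_derivInv (hf : IsC1Diffeo f fInv Df DfInv) (y : B) :
    Df (fInv y) ∘L DfInv y = ContinuousLinearMap.id ℝ B := by
  have h := (hf.2.2.1 (fInv y)).comp y (hf.2.2.2 y)
  have hid : f ∘ fInv = id := funext hf.2.1
  rw [hid] at h
  exact h.unique (hasFDerivAt_id y)

omit [CompleteSpace B] in
lemma IsC1Diffeo.derivInv_comp_deriv (hf : IsC1Diffeo f fInv Df DfInv) (y : B) :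
    DfInv y ∘L Df (fInv y) = ContinuousLinearMap.id ℝ B := by
  have h := hf.symm.deriv_comp_derivInv (fInv y)
  rwa [hf.2.1] at h

omit [CompleteSpace B] in
/-- A radius on which the modulus of continuity is small. -/
lemma C1Reg.exists_modulus_le (hreg : C1Reg f Df DfInv R r) {ε : ℝ} (hε : 0 < ε) :
    ∃ ρ > 0, ∀ t, 0 ≤ t → t ≤ ρ → r t ≤ ε := by
  obtain ⟨-, hmono, -, hlim, -⟩ := hreg
  obtain ⟨ρ, hρ, hρ0⟩ := ((hlim.eventually (ge_mem_nhds hε)).and self_mem_nhdsWithin).exists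
  exact ⟨ρ, hρ0, fun t ht htρ => (hmono ht (le_of_lt hρ0) htρ).trans hρ⟩

omit [CompleteSpace B] in
lemma C1Reg.uniformContinuous_deriv (hreg : C1Reg f Df DfInv R r) : UniformContinuous Df := by
  refine Metric.uniformContinuous_iff.2 fun ε hε => ?_
  obtain ⟨ρ, hρ, hr⟩ := hreg.exists_modulus_le (half_pos hε)
  refine ⟨ρ, hρ, fun {x y} hxy => ?_⟩
  rw [dist_eq_norm] at hxy ⊢
  have h := hreg.2.2.2.2.2.2.2 y (x - y)
  rw [add_sub_cancel] at h
  linarith [hr _ (norm_nonneg _) hxy.le]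

omit [CompleteSpace B] in
lemma uniformContinuous_derivInv (hf : IsC1Diffeo f fInv Df DfInv)
    (hreg : C1Reg f Df DfInv R r) : UniformContinuous DfInv := by
  have huc : UniformContinuous fun y => Df (fInv y) := hreg.uniformContinuous_deriv.comp
    (uniformContinuous_of_hasFDerivAt_of_bounded hf.2.2.2 hreg.2.2.2.2.2.2.1)
  have hR0 := hreg.1
  have hR := hreg.2.2.2.2.2.2.1
  refine Metric.uniformContinuous_iff.2 fun ε hε => ?_
  obtain ⟨δ, hδ, h⟩ := Metric.uniformContinuous_iff.1 huc (ε / R ^ 2) (by positivity)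
  refine ⟨δ, hδ, fun {x y} hxy => ?_⟩
  have hxy' := h hxy
  rw [dist_eq_norm'] at hxy'
  rw [dist_eq_norm]
  have hsplit : DfInv x - DfInv y = DfInv x ∘L ((Df (fInv y) - Df (fInv x)) ∘L DfInv y) := by
    rw [ContinuousLinearMap.sub_comp, ContinuousLinearMap.comp_sub, hf.deriv_comp_derivInv,
      ← ContinuousLinearMap.comp_assoc, hf.derivInv_comp_deriv, ContinuousLinearMap.comp_id,
      ContinuousLinearMap.id_comp]
  rw [hsplit]
  calc _ ≤ R * (‖Df (fInv y) - Df (fInv x)‖ * R) := by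
        refine (ContinuousLinearMap.opNorm_comp_le _ _).trans (mul_le_mul (hR x) ?_
          (norm_nonneg _) hR0.le)
        exact (ContinuousLinearMap.opNorm_comp_le _ _).trans (by gcongr; exact hR y)
    _ < R * (ε / R ^ 2 * R) := by gcongr
    _ = ε := by field_simp

omit [CompleteSpace B] in
/-- For every homeomorphism `φ` close to `f`, the transfer operator of `Df` over `φ` admits
an approximate right inverse of uniformly bounded norm. -/
lemma exists_approx_rightInverse (hf : IsC1Diffeo f fInv Df DfInv) (hreg : C1Reg f Df DfInv R r)
    {C lam : ℝ} (hC : 0 < C) (hlam : lam ∈ Set.Ioo (0 : ℝ) 1) {P Q : B → B →L[ℝ] B}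
    (hCL : IsGenCL f fInv Df DfInv C lam P Q) (hP : Continuous P) (hQ : Continuous Q) :
    ∃ K > 0, ∃ δ > 0, ∀ (φ φInv : B → B), Continuous φ → ∀ (hφInv : Continuous φInv),
      Function.LeftInverse φInv φ → Function.RightInverse φInv φ → (∀ x, ‖f x - φ x‖ ≤ δ) →
        ∃ S : (B →ᵇ B) →L[ℝ] (B →ᵇ B), ‖S‖ ≤ K ∧
          ‖1 - (1 - weightedComp φInv Df hφInv hreg.uniformContinuous_deriv.continuous
            hreg.2.2.2.2.2.1) * S‖ ≤ 1 / 4 := by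
  have hucDf := hreg.uniformContinuous_deriv
  have hucDfInv := uniformContinuous_derivInv hf hreg
  obtain ⟨hR, -, -, -, -, hDfR, hDfInvR, -⟩ := id hreg
  obtain ⟨hPQ, hPC, hQC, -, -, hPcontr, hQcontr⟩ := hCL
  have hucf := uniformContinuous_of_hasFDerivAt_of_bounded hf.2.2.1 hDfR
  have hucfInv := uniformContinuous_of_hasFDerivAt_of_bounded hf.2.2.2 hDfInvR
  obtain ⟨n, hn⟩ := exists_pow_lt_of_lt_one (show 0 < 1 / (16 * C ^ 2) by positivity) hlam.2
  have hn' : C * lam ^ n * C ≤ 1 / 16 := by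
    calc C * lam ^ n * C ≤ C * (1 / (16 * C ^ 2)) * C := by gcongr
      _ = 1 / 16 := by field_simp
  obtain ⟨δ₁, hδ₁, h₁⟩ :=
    exists_norm_orbitDeriv_apply_le hucf hucDf hDfR hC hlam.1 hPC hPcontr hn'
  obtain ⟨δ₂, hδ₂, h₂⟩ :=
    exists_norm_orbitDeriv_apply_le hucfInv hucDfInv hDfInvR hC hlam.1 hQC hQcontr hn'
  obtain ⟨δ₃, hδ₃, h₃⟩ := Metric.uniformContinuous_iff.1 hucfInv δ₂ hδ₂
  obtain ⟨δ₄, hδ₄, h₄⟩ := Metric.uniformContinuous_iff.1 hucDfInv δ₂ hδ₂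
  refine ⟨(∑ i ∈ Finset.range n, R ^ i) * C + R * (∑ i ∈ Finset.range n, R ^ i) * C + 1,
    by positivity, min δ₁ (min (δ₃ / 2) (δ₄ / 2)), by positivity,
    fun φ φInv hφ hφInv hl hr hclose => ?_⟩
  simp only [le_min_iff] at hclose
  have hbc : Continuous fun y => DfInv (f (φInv y)) :=
    hucDfInv.continuous.comp (hucf.continuous.comp hφInv)
  set a := weightedComp φInv Df hφInv hucDf.continuous hDfR with ha
  set b := weightedComp φ (fun y => DfInv (f (φInv y))) hφ hbc (fun y => hDfInvR _) with hb
  set p := weightedComp id P continuous_id hP hPC with hp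
  set q := weightedComp id Q continuous_id hQ hQC with hq
  have hab : a * b = 1 := by
    ext w x
    have h := hf.deriv_comp_derivInv (f (φInv x))
    rw [hf.1] at h
    have h' := DFunLike.congr_fun h (w x)
    simpa [ha, hb, hr x] using h'
  have hpq : p + q = 1 := by
    ext w x
    simpa [hp, hq] using DFunLike.congr_fun (hPQ x) (w x)
  have hpow : ∀ c : (B →ᵇ B) →L[ℝ] (B →ᵇ B), ‖c‖ ≤ R →
      ‖∑ i ∈ Finset.range n, c ^ i‖ ≤ ∑ i ∈ Finset.range n, R ^ i := fun c hc => by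
    refine norm_sum_le_of_le _ fun i hi => ?_
    clear hi
    induction i with
    | zero => rw [pow_zero, pow_zero]; exact ContinuousLinearMap.norm_id_le
    | succ i ih => rw [pow_succ, pow_succ]; exact norm_mul_le_of_le ih hc
  have haR : ‖a‖ ≤ R := norm_weightedComp_le _ _ _
  have hbR : ‖b‖ ≤ R := norm_weightedComp_le _ _ _
  have hpC : ‖p‖ ≤ C := norm_weightedComp_le _ _ _
  have hqC : ‖q‖ ≤ C := norm_weightedComp_le _ _ _
  refine ⟨(∑ i ∈ Finset.range n, a ^ i) * p - b * (∑ i ∈ Finset.range n, b ^ i) * q, ?_, ?_⟩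
  · have e1 : ‖(∑ i ∈ Finset.range n, a ^ i) * p‖ ≤ (∑ i ∈ Finset.range n, R ^ i) * C :=
      norm_mul_le_of_le (hpow a haR) hpC
    have e2 : ‖b * (∑ i ∈ Finset.range n, b ^ i) * q‖ ≤ R * (∑ i ∈ Finset.range n, R ^ i) * C :=
      norm_mul_le_of_le (norm_mul_le_of_le hbR (hpow b hbR)) hqC
    linarith [norm_sub_le ((∑ i ∈ Finset.range n, a ^ i) * p)
      (b * (∑ i ∈ Finset.range n, b ^ i) * q)]
  · rw [one_sub_mul_truncatedGreen hab hpq]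
    have e1 : ‖a ^ n * p‖ ≤ 1 / 8 :=
      norm_weightedComp_pow_mul_le _ _ _ hr n hP hPC (by norm_num)
        (h₁ φ Df hDfR (fun x => (hclose x).1) fun x => by simpa using hδ₁.le)
    have hfφ : ∀ y, ‖y - f (φInv y)‖ ≤ δ₃ / 2 ∧ ‖y - f (φInv y)‖ ≤ δ₄ / 2 := fun y => by
      have h := (hclose (φInv y)).2
      rwa [hr, norm_sub_rev] at h
    have e2 : ‖b ^ n * q‖ ≤ 1 / 8 := by
      refine norm_weightedComp_pow_mul_le _ _ _ hl n hQ hQC (by norm_num)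
        (h₂ φInv _ (fun y => hDfInvR _) (fun y => ?_) fun y => ?_)
      · have h := h₃ (a := y) (b := f (φInv y)) (by rw [dist_eq_norm]; linarith [(hfφ y).1])
        rw [hf.1, dist_eq_norm] at h
        exact h.le
      · have h := h₄ (a := y) (b := f (φInv y)) (by rw [dist_eq_norm]; linarith [(hfφ y).2])
        rw [dist_eq_norm] at h
        exact h.le
    linarith [norm_add_le (a ^ n * p) (b ^ n * q)]

/-- If `φ` and `ψ` are both close to `f`, there is a small continuous `h` with
`ψ ∘ (Id + h) = (Id + h) ∘ φ`. -/
lemma exists_semiconj_of_close (hf : IsC1Diffeo f fInv Df DfInv) (hreg : C1Reg f Df DfInv R r)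
    {C lam : ℝ} (hC : 0 < C) (hlam : lam ∈ Set.Ioo (0 : ℝ) 1) {P Q : B → B →L[ℝ] B}
    (hCL : IsGenCL f fInv Df DfInv C lam P Q) (hP : Continuous P) (hQ : Continuous Q) :
    ∃ M > 0, ∃ d₀ > 0, ∀ d, 0 < d → d < d₀ → ∀ (φ φInv ψ : B → B) (Dψ : B → B →L[ℝ] B),
      Continuous φ → Continuous φInv → Function.LeftInverse φInv φ →
      Function.RightInverse φInv φ → (∀ x, HasFDerivAt ψ (Dψ x) x) →
      (∀ x, ‖f x - φ x‖ ≤ d) → (∀ x, ‖ψ x - φ x‖ ≤ d) → (∀ x, ‖Dψ x - Df x‖ ≤ d) →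
        ∃ h : B → B, Continuous h ∧ (∀ x, ψ (x + h x) = φ x + h (φ x)) ∧
          ∀ x, ‖h x‖ < M * d := by
  obtain ⟨K, hK, δ, hδ, hS⟩ := exists_approx_rightInverse hf hreg hC hlam hCL hP hQ
  obtain ⟨ρ, hρ, hrρ⟩ := hreg.exists_modulus_le (show 0 < 1 / (8 * K) by positivity)
  refine ⟨2 * K + 1, by positivity, min δ (min (1 / (8 * K)) (ρ / (2 * K))), by positivity,
    fun d hd hdd φ φInv ψ Dψ hφ hφInv hl hr hψ hfφ hψφ hDψ => ?_⟩
  simp only [lt_min_iff] at hdd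
  obtain ⟨hdδ, hdK, hdρ⟩ := hdd
  obtain ⟨S, hSK, hSE⟩ := hS φ φInv hφ hφInv hl hr fun x => (hfφ x).trans hdδ.le
  have hρ' : K * (2 * d) ≤ ρ := by
    rw [lt_div_iff₀ (by positivity)] at hdρ
    linarith
  have hψc : Continuous ψ := continuous_iff_continuousAt.2 fun x => (hψ x).continuousAt
  have hDfc := hreg.uniformContinuous_deriv.continuous
  have hbound : ∀ (h : B →ᵇ B) (x : B),
      ‖ψ (φInv x + h (φInv x)) - x - Df (φInv x) (h (φInv x))‖ ≤ 3 * d + ‖h‖ * r ‖h‖ := by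
    intro h x
    set z := φInv x
    have hz : φ z = x := hr x
    have e1 := hreg.2.2.2.2.1 z (h z)
    have e2 : ‖h z‖ * r ‖h z‖ ≤ ‖h‖ * r ‖h‖ :=
      mul_le_mul (h.norm_coe_le_norm z) (hreg.2.1 (norm_nonneg _) (norm_nonneg _)
        (h.norm_coe_le_norm z)) (hreg.2.2.1 _ (norm_nonneg _)) (norm_nonneg _)
    have e3 : ψ (z + h z) - x - Df z (h z) = (ψ (z + h z) - φ (z + h z)) -
        (f (z + h z) - φ (z + h z)) + (f z - φ z) + (f (z + h z) - f z - Df z (h z)) := by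
      rw [hz]; abel
    rw [e3]
    refine (norm_add₃_le).trans ?_
    linarith [norm_sub_le (ψ (z + h z) - φ (z + h z)) (f (z + h z) - φ (z + h z)),
      hψφ (z + h z), hfφ (z + h z), hfφ z]
  let 𝒩 : (B →ᵇ B) → (B →ᵇ B) := fun h => BoundedContinuousFunction.ofNormedAddCommGroup
    (fun x => ψ (φInv x + h (φInv x)) - x - Df (φInv x) (h (φInv x))) (by fun_prop)
    _ (hbound h)
  have h𝒩 : ∀ h x, 𝒩 h x = ψ (φInv x + h (φInv x)) - x - Df (φInv x) (h (φInv x)) :=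
    fun _ _ => rfl
  have h0 : ‖𝒩 0‖ ≤ d := by
    refine (BoundedContinuousFunction.norm_le hd.le).2 fun x => ?_
    have h := hψφ (φInv x)
    rw [hr] at h
    simpa [h𝒩] using h
  have hLip : ∀ h h', ‖h‖ ≤ K * (2 * d) → ‖h'‖ ≤ K * (2 * d) →
      ‖𝒩 h - 𝒩 h'‖ ≤ 1 / (4 * K) * ‖h - h'‖ := by
    intro h h' hh hh'
    refine (BoundedContinuousFunction.norm_le (by positivity)).2 fun x => ?_
    set z := φInv x with hz
    have hderiv : ∀ v ∈ Metric.closedBall (0 : B) (K * (2 * d)),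
        HasFDerivWithinAt (fun v => ψ (z + v) - x - Df z v) (Dψ (z + v) - Df z)
          (Metric.closedBall 0 (K * (2 * d))) v := fun v _ =>
      ((((hasFDerivAt_comp_add_left z).2 (hψ (z + v))).sub_const x).sub (Df z).hasFDerivAt).hasFDerivWithinAt
    have hnorm : ∀ v ∈ Metric.closedBall (0 : B) (K * (2 * d)),
        ‖Dψ (z + v) - Df z‖ ≤ 1 / (4 * K) := fun v hv => by
      have e1 := hreg.2.2.2.2.2.2.2 z v
      have e2 := hrρ ‖v‖ (norm_nonneg _) ((mem_closedBall_zero_iff.1 hv).trans hρ')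
      have e3 : 1 / (4 * K) = 1 / (8 * K) + 1 / (8 * K) := by field_simp; norm_num
      linarith [norm_sub_le_norm_sub_add_norm_sub (Dψ (z + v)) (Df (z + v)) (Df z), hDψ (z + v)]
    have e := (convex_closedBall (0 : B) (K * (2 * d))).norm_image_sub_le_of_norm_hasFDerivWithin_le
      hderiv hnorm (mem_closedBall_zero_iff.2 ((h'.norm_coe_le_norm z).trans hh'))
      (mem_closedBall_zero_iff.2 ((h.norm_coe_le_norm z).trans hh))
    refine e.trans ?_
    gcongr
    exact (h - h').norm_coe_le_norm z
  obtain ⟨h, hh, heq⟩ := exists_eq_add_of_approx_rightInverse _ S 𝒩 hSE hSK h0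
    (by positivity) (by field_simp; norm_num) hLip
  refine ⟨h, h.continuous, fun x => ?_, fun x => ?_⟩
  · have e := DFunLike.congr_fun heq (φ x)
    rw [BoundedContinuousFunction.add_apply, weightedComp_apply, h𝒩, hl] at e
    rw [e]
    abel
  · linarith [h.norm_coe_le_norm x]

end Diffeo

/-- Weak structural stability: if `f` satisfies the `C¹` regularity
conditions and a *uniformly continuous* generalized `(C, λ)`-structure, then there exist
`M, d₀ > 0` such that every `C¹` diffeomorphism `g` with `‖f − g‖_{C¹} < d < d₀` is
semiconjugate to `f` from both sides via continuous maps `Id + h₁`, `Id + h₂` with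
`‖h₁‖, ‖h₂‖ < M d`. -/
theorem statement16
    {B : Type*} [NormedAddCommGroup B] [NormedSpace ℝ B] [CompleteSpace B]
    (f fInv : B → B) (Df DfInv : B → B →L[ℝ] B) (R : ℝ) (r : ℝ → ℝ)
    (hf : IsC1Diffeo f fInv Df DfInv) (hreg : C1Reg f Df DfInv R r)
    (C lam : ℝ) (hC : 0 < C) (hlam : lam ∈ Set.Ioo (0 : ℝ) 1)
    (P Q : B → B →L[ℝ] B) (hCL : IsGenCL f fInv Df DfInv C lam P Q)
    (hPuc : UniformContinuous fun x => P x) (hQuc : UniformContinuous fun x => Q x) :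
    ∃ M d₀ : ℝ, 0 < M ∧ 0 < d₀ ∧
      ∀ d : ℝ, 0 < d → d < d₀ →
        ∀ (g gInv : B → B) (Dg DgInv : B → B →L[ℝ] B),
          IsC1Diffeo g gInv Dg DgInv →
          (∀ x, ‖f x - g x‖ + ‖Df x - Dg x‖ < d) →
          ∃ h₁ h₂ : B → B, Continuous h₁ ∧ Continuous h₂ ∧
            (∀ x, g (x + h₁ x) = f x + h₁ (f x)) ∧
            (∀ x, f (x + h₂ x) = g x + h₂ (g x)) ∧
            (∀ x, ‖h₁ x‖ < M * d) ∧ (∀ x, ‖h₂ x‖ < M * d) := by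
  obtain ⟨M, hM, d₀, hd₀, H⟩ :=
    exists_semiconj_of_close hf hreg hC hlam hCL hPuc.continuous hQuc.continuous
  refine ⟨M, d₀, hM, hd₀, fun d hd hdd g gInv Dg DgInv hg hfg => ?_⟩
  have hcont : ∀ {u : B → B} {Du : B → B →L[ℝ] B}, (∀ x, HasFDerivAt u (Du x) x) →
      Continuous u := fun hu => continuous_iff_continuousAt.2 fun x => (hu x).continuousAt
  have hfg₀ : ∀ x, ‖f x - g x‖ ≤ d := fun x => by linarith [hfg x, norm_nonneg (Df x - Dg x)]
  have hfg₁ : ∀ x, ‖Dg x - Df x‖ ≤ d := fun x => by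
    rw [norm_sub_rev]
    linarith [hfg x, norm_nonneg (f x - g x)]
  obtain ⟨h₁, hc₁, he₁, hb₁⟩ := H d hd hdd f fInv g Dg (hcont hf.2.2.1) (hcont hf.2.2.2) hf.1
    hf.2.1 hg.2.2.1 (fun x => by simpa using hd.le)
    (fun x => by rw [norm_sub_rev]; exact hfg₀ x) hfg₁
  obtain ⟨h₂, hc₂, he₂, hb₂⟩ := H d hd hdd g gInv f Df (hcont hg.2.2.1) (hcont hg.2.2.2) hg.1
    hg.2.1 hf.2.2.1 hfg₀ hfg₀ (fun x => by simpa using hd.le)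
  exact ⟨h₁, h₂, hc₁, hc₂, he₁, he₂, hb₁, hb₂⟩

end
end

section
/- Let B = ℓ^p(ℤ) with p ∈ [1,∞]. Define the sequence of bounded linear operators A = {A_k : B → B}_{k∈ℤ} by (A_k x)_m = (1/2)x_m if m ≤ k and (A_k x)_m = 2x_m if m > k. Then: (i) A satisfies a generalized (C,λ)-structure with C = 1 and λ = 1/2 (with projections (P_k x)_m = x_m for m ≤ k, 0 otherwise, and Q_k = Id − P_k); (ii) A does not admit an exponential dichotomy on ℤ⁺ and does not admit an exponential dichotomy on ℤ⁻. -/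
open Set Filter

noncomputable section

variable {B : Type*} [NormedAddCommGroup B] [NormedSpace ℝ B] [CompleteSpace B]

/-- Forward product `fwd A k n = A_{k+n-1} ⋯ A_{k+1} A_k`. -/
def fwd (A : ℤ → B ≃L[ℝ] B) (k : ℤ) : ℕ → B →L[ℝ] B
  | 0 => ContinuousLinearMap.id ℝ B
  | (n + 1) => ((A (k + n) : B →L[ℝ] B)) ∘L fwd A k n

/-- Backward product `bwd A k n = A_{k-n}⁻¹ ⋯ A_{k-2}⁻¹ A_{k-1}⁻¹`. -/
def bwd (A : ℤ → B ≃L[ℝ] B) (k : ℤ) : ℕ → B →L[ℝ] B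
  | 0 => ContinuousLinearMap.id ℝ B
  | (n + 1) => (((A (k - n - 1)).symm : B →L[ℝ] B)) ∘L bwd A k n

/-- Generalized `(C, λ)`-structure for a sequence of linear isomorphisms. -/
def SeqGenCL (A : ℤ → B ≃L[ℝ] B) (C lam : ℝ) (P Q : ℤ → B →L[ℝ] B) : Prop :=
  (∀ k, P k + Q k = ContinuousLinearMap.id ℝ B) ∧
  (∀ k, ‖P k‖ ≤ C) ∧ (∀ k, ‖Q k‖ ≤ C) ∧
  (∀ k, Set.MapsTo (A k) (Set.range (P k)) (Set.range (P (k + 1)))) ∧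
  (∀ k, Set.MapsTo (A k).symm (Set.range (Q (k + 1))) (Set.range (Q k))) ∧
  (∀ (k : ℤ) (n : ℕ) (v : B), v ∈ Set.range (P k) → ‖fwd A k n v‖ ≤ C * lam ^ n * ‖v‖) ∧
  (∀ (k : ℤ) (n : ℕ) (v : B), v ∈ Set.range (Q k) → ‖bwd A k n v‖ ≤ C * lam ^ n * ‖v‖)

/-- Exponential dichotomy of a sequence of isomorphisms on an interval `I ⊆ ℤ`. -/
def EDOn (I : Set ℤ) (A : ℤ → B ≃L[ℝ] B) : Prop :=
  ∃ (C lam : ℝ) (P Q : ℤ → B →L[ℝ] B), 0 < C ∧ lam ∈ Set.Ioo (0 : ℝ) 1 ∧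
    (∀ k, P k + Q k = ContinuousLinearMap.id ℝ B) ∧
    (∀ k, ‖P k‖ ≤ C ∧ ‖Q k‖ ≤ C) ∧
    (∀ k, k ∈ I → k + 1 ∈ I →
      (A k) '' Set.range (P k) = Set.range (P (k + 1)) ∧
      (A k).symm '' Set.range (Q (k + 1)) = Set.range (Q k)) ∧
    (∀ (k : ℤ) (n : ℕ) (v : B), k ∈ I → k + (n : ℤ) ∈ I → v ∈ Set.range (P k) →
      ‖fwd A k n v‖ ≤ C * lam ^ n * ‖v‖) ∧
    (∀ (k : ℤ) (n : ℕ) (v : B), k - (n : ℤ) ∈ I → k ∈ I → v ∈ Set.range (Q k) →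
      ‖bwd A k n v‖ ≤ C * lam ^ n * ‖v‖)

/-- Forward cocycle power `A^n_α(x) = A(α^{n-1} x) ⋯ A(α x) A(x)`. -/
def cocFwd (α : B → B) (A : B → B ≃L[ℝ] B) : ℕ → B → B →L[ℝ] B
  | 0, _ => ContinuousLinearMap.id ℝ B
  | (n + 1), x => cocFwd α A n (α x) ∘L (A x : B →L[ℝ] B)

/-- Backward cocycle power `A^{-n}_α(x) = A(α^{-n} x)⁻¹ ⋯ A(α^{-1} x)⁻¹`. -/
def cocBwd (αInv : B → B) (A : B → B ≃L[ℝ] B) : ℕ → B → B →L[ℝ] B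
  | 0, _ => ContinuousLinearMap.id ℝ B
  | (n + 1), x => cocBwd αInv A n (αInv x) ∘L ((A (αInv x)).symm : B →L[ℝ] B)

/-- The cocycle `(C, λ)` property for the pair `(α, A)`. -/
def CocycleCL (α αInv : B → B) (A : B → B ≃L[ℝ] B) (C lam : ℝ)
    (P Q : B → B →L[ℝ] B) : Prop :=
  (∀ x, P x + Q x = ContinuousLinearMap.id ℝ B) ∧
  (∀ x, ‖P x‖ ≤ C) ∧ (∀ x, ‖Q x‖ ≤ C) ∧
  (∀ x, Set.MapsTo (A x) (Set.range (P x)) (Set.range (P (α x)))) ∧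
  (∀ x, Set.MapsTo (A x).symm (Set.range (Q (α x))) (Set.range (Q x))) ∧
  (∀ x (n : ℕ) (v : B), v ∈ Set.range (P x) → ‖cocFwd α A n x v‖ ≤ C * lam ^ n * ‖v‖) ∧
  (∀ x (n : ℕ) (v : B), v ∈ Set.range (Q x) → ‖cocBwd αInv A n x v‖ ≤ C * lam ^ n * ‖v‖)

/-- In `ℓ^p`, a coordinatewise bound of norms gives a bound of norms. -/
theorem lp_norm_le_of_forall_norm_le {ι : Type*} {E : ι → Type*}
    [∀ i, NormedAddCommGroup (E i)] {p : ENNReal} (hp : p ≠ 0) {x y : lp E p}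
    (h : ∀ i, ‖x i‖ ≤ ‖y i‖) : ‖x‖ ≤ ‖y‖ := by
  rcases p.trichotomy with (rfl | rfl | hp')
  · exact absurd rfl hp
  · exact lp.norm_le_of_forall_le (lp.norm_nonneg' y)
      fun i => (h i).trans (lp.norm_apply_le_norm hp y i)
  · refine lp.norm_le_of_forall_sum_le hp' (lp.norm_nonneg' y) fun s => ?_
    refine (Finset.sum_le_sum fun i _ => ?_).trans (lp.sum_rpow_le_norm_rpow hp' y s)
    exact Real.rpow_le_rpow (norm_nonneg _) (h i) hp'.le

/-- The time reversal `k ↦ A_{-k-1}⁻¹` of a sequence of isomorphisms. -/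
def timeReversal (A : ℤ → B ≃L[ℝ] B) (k : ℤ) : B ≃L[ℝ] B := (A (-k - 1)).symm

omit [CompleteSpace B] in
theorem fwd_timeReversal (A : ℤ → B ≃L[ℝ] B) (k : ℤ) (n : ℕ) :
    fwd (timeReversal A) k n = bwd A (-k) n := by
  induction n with
  | zero => rfl
  | succ n ih => rw [fwd, bwd, ih, timeReversal, neg_add']

omit [CompleteSpace B] in
theorem bwd_timeReversal (A : ℤ → B ≃L[ℝ] B) (k : ℤ) (n : ℕ) :
    bwd (timeReversal A) k n = fwd A (-k) n := by
  induction n with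
  | zero => rfl
  | succ n ih =>
    rw [fwd, bwd, ih, timeReversal, ContinuousLinearEquiv.symm_symm,
      show -(k - n - 1) - 1 = -k + (n : ℤ) by ring]

omit [CompleteSpace B] in
/-- A dichotomy on `ℤ⁻` becomes a dichotomy on `ℤ⁺` under time reversal. -/
theorem EDOn.timeReversal {A : ℤ → B ≃L[ℝ] B} (h : EDOn {k : ℤ | k ≤ 0} A) :
    EDOn {k : ℤ | 0 ≤ k} (timeReversal A) := by
  obtain ⟨C, lam, P, Q, hC, hlam, hPQ, hbd, hinv, hs, hu⟩ := h
  simp only [mem_ofPred_eq] at hinv hs hu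
  refine ⟨C, lam, fun k => Q (-k), fun k => P (-k), hC, hlam, fun k => ?_,
    fun k => (hbd (-k)).symm, fun k hk _ => ?_, fun k n v hk _ hv => ?_,
    fun k n v hk _ hv => ?_⟩
  · rw [add_comm, hPQ]
  · rw [mem_ofPred_eq] at hk
    have h := hinv (-k - 1) (by omega) (by omega)
    rw [sub_add_cancel] at h
    simpa only [_root_.timeReversal, neg_add', ContinuousLinearEquiv.symm_symm] using h.symm
  · rw [mem_ofPred_eq] at hk
    rw [fwd_timeReversal]
    exact hu (-k) n v (by omega) (by omega) hv
  · rw [mem_ofPred_eq] at hk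
    rw [bwd_timeReversal]
    exact hs (-k) n v (by omega) (by omega) hv

omit [CompleteSpace B] in
theorem bwd_fwd (A : ℤ → B ≃L[ℝ] B) (k : ℤ) (n j : ℕ) (v : B) :
    bwd A (k + (n + j : ℕ)) j (fwd A k (n + j) v) = fwd A k n v := by
  induction j generalizing n with
  | zero => rfl
  | succ j ih =>
    have h := ih (n + 1)
    rw [show n + 1 + j = n + (j + 1) by ring] at h
    rw [bwd, ContinuousLinearMap.comp_apply, h, fwd,
      show k + ((n + (j + 1) : ℕ) : ℤ) - j - 1 = k + n by push_cast; ring]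
    simp

omit [CompleteSpace B] in
/-- In the presence of a dichotomy on `ℤ⁺`, vectors with bounded forward orbit decay
exponentially, with uniform constants. -/
theorem EDOn.exists_norm_fwd_le {A : ℤ → B ≃L[ℝ] B} (h : EDOn {k : ℤ | 0 ≤ k} A) :
    ∃ C lam : ℝ, 0 < C ∧ lam ∈ Set.Ioo (0 : ℝ) 1 ∧
      ∀ v : B, (∃ M, ∀ n, ‖fwd A 0 n v‖ ≤ M) → ∀ n, ‖fwd A 0 n v‖ ≤ C * lam ^ n * ‖v‖ := by
  obtain ⟨C, lam, P, Q, hC, hlam, hPQ, -, hinv, hs, hu⟩ := h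
  simp only [mem_ofPred_eq] at hinv hs hu
  refine ⟨C, lam, hC, hlam, fun v ⟨M, hM⟩ => ?_⟩
  have hsplit : P 0 v + Q 0 v = v := by
    simpa using congrArg (fun T : B →L[ℝ] B => T v) (hPQ 0)
  have hrange (n : ℕ) : fwd A 0 n (Q 0 v) ∈ Set.range (Q n) := by
    induction n with
    | zero => exact ⟨v, rfl⟩
    | succ n ih =>
      rw [← (hinv n (by omega) (by omega)).2] at ih
      obtain ⟨w, hw, hwv⟩ := ih
      rw [fwd, ContinuousLinearMap.comp_apply, ← hwv, zero_add]
      simpa using hw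
  have hP (n : ℕ) : ‖fwd A 0 n (P 0 v)‖ ≤ C * ‖P 0 v‖ := by
    refine (hs 0 n _ le_rfl (by omega) ⟨v, rfl⟩).trans ?_
    gcongr
    exact mul_le_of_le_one_right hC.le (pow_le_one₀ hlam.1.le hlam.2.le)
  have hQ (n : ℕ) : ‖Q 0 v‖ ≤ C * lam ^ n * (M + C * ‖P 0 v‖) := by
    have hback := bwd_fwd A 0 0 n (Q 0 v)
    rw [zero_add, zero_add] at hback
    have hle := hu n n _ (by omega) (by omega) (hrange n)
    rw [hback] at hle
    refine hle.trans (mul_le_mul_of_nonneg_left ?_ (by have := hlam.1; positivity))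
    rw [show Q 0 v = v - P 0 v from eq_sub_of_add_eq' hsplit, map_sub]
    exact (norm_sub_le _ _).trans (add_le_add (hM n) (hP n))
  have hlim : Tendsto (fun n : ℕ => C * lam ^ n * (M + C * ‖P 0 v‖)) atTop (nhds 0) := by
    simpa using ((tendsto_pow_atTop_nhds_zero_of_lt_one hlam.1.le hlam.2).const_mul C).mul_const
      (M + C * ‖P 0 v‖)
  have hQ0 : Q 0 v = 0 := norm_le_zero_iff.mp (ge_of_tendsto' hlim hQ)
  exact fun n => hs 0 n v le_rfl (by omega) ⟨v, by simpa [hQ0] using hsplit⟩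

omit [CompleteSpace B] in
/-- Arbitrarily long transient growth of vectors that eventually decay rules out a dichotomy
on `ℤ⁺`. -/
theorem not_EDOn_of_transient_growth {A : ℤ → B ≃L[ℝ] B}
    (h : ∀ N : ℕ, ∃ v : B, v ≠ 0 ∧ (∀ k : ℕ, k < N → A k v = (2 : ℝ) • v) ∧
      ∀ k : ℕ, N ≤ k → A k v = (1 / 2 : ℝ) • v) :
    ¬ EDOn {k : ℤ | 0 ≤ k} A := by
  intro hED
  obtain ⟨C, lam, hC, hlam, hdecay⟩ := hED.exists_norm_fwd_le
  obtain ⟨N, hN⟩ := pow_unbounded_of_one_lt C (one_lt_two (α := ℝ))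
  obtain ⟨v, hv, hgrow, hshrink⟩ := h N
  have hfwd (n : ℕ) (hn : n ≤ N) : fwd A 0 n v = (2 ^ n : ℝ) • v := by
    induction n with
    | zero => simp [fwd]
    | succ n ih =>
      rw [fwd, ContinuousLinearMap.comp_apply, ih (by omega), map_smul, zero_add,
        ContinuousLinearEquiv.coe_coe, hgrow n (by omega), smul_smul, pow_succ]
  have hbound (n : ℕ) : ∃ c : ℝ, 0 ≤ c ∧ c ≤ 2 ^ N ∧ fwd A 0 n v = c • v := by
    induction n with
    | zero => exact ⟨1, zero_le_one, one_le_pow₀ one_le_two, by simp [fwd]⟩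
    | succ n ih =>
      rcases le_or_gt (n + 1) N with hn | hn
      · exact ⟨2 ^ (n + 1), by positivity, pow_le_pow_right₀ one_le_two hn, hfwd _ hn⟩
      · obtain ⟨c, hc0, hc, hcv⟩ := ih
        refine ⟨c * (1 / 2), by positivity, by linarith, ?_⟩
        rw [fwd, ContinuousLinearMap.comp_apply, hcv, map_smul, zero_add,
          ContinuousLinearEquiv.coe_coe, hshrink n (by omega), smul_smul]
  have hle := hdecay v ⟨2 ^ N * ‖v‖, fun n => by
    obtain ⟨c, hc0, hc, hcv⟩ := hbound n
    rw [hcv, norm_smul, Real.norm_of_nonneg hc0]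
    gcongr⟩ N
  rw [hfwd N le_rfl, norm_smul, Real.norm_of_nonneg (by positivity)] at hle
  have hle' := le_of_mul_le_mul_right hle (norm_pos_iff.mpr hv)
  have : C * lam ^ N ≤ C := mul_le_of_le_one_right hC.le (pow_le_one₀ hlam.1.le hlam.2.le)
  linarith

/-- The weighted shift-type sequence `(A_k x)_m = x_m/2` for `m ≤ k`,
`(A_k x)_m = 2 x_m` for `m > k`, on `ℓ^p(ℤ)`: it satisfies a generalized
`(1, 1/2)`-structure, but admits no exponential dichotomy on `ℤ⁺` nor on `ℤ⁻`. -/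
theorem statement17 (p : ENNReal) [Fact (1 ≤ p)]
    (A : ℤ → lp (fun _ : ℤ => ℝ) p ≃L[ℝ] lp (fun _ : ℤ => ℝ) p)
    (hA : ∀ (k : ℤ) (x : lp (fun _ : ℤ => ℝ) p) (m : ℤ),
      A k x m = if m ≤ k then x m / 2 else 2 * x m)
    (P Q : ℤ → lp (fun _ : ℤ => ℝ) p →L[ℝ] lp (fun _ : ℤ => ℝ) p)
    (hP : ∀ (k : ℤ) (x : lp (fun _ : ℤ => ℝ) p) (m : ℤ),
      P k x m = if m ≤ k then x m else 0)
    (hQ : ∀ k, Q k = ContinuousLinearMap.id ℝ (lp (fun _ : ℤ => ℝ) p) - P k) :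
    SeqGenCL A 1 (1 / 2) P Q ∧
    ¬ EDOn {k : ℤ | 0 ≤ k} A ∧ ¬ EDOn {k : ℤ | k ≤ 0} A := by
  have hp : p ≠ 0 := (zero_lt_one.trans_le Fact.out).ne'
  have hQ' (k : ℤ) (x : lp (fun _ : ℤ => ℝ) p) (m : ℤ) :
      Q k x m = if m ≤ k then 0 else x m := by
    have h : Q k x m = x m - P k x m := by rw [hQ]; rfl
    rw [h, hP]
    split_ifs <;> simp
  have hA' (k : ℤ) (x : lp (fun _ : ℤ => ℝ) p) (m : ℤ) :
      (A k).symm x m = if m ≤ k then 2 * x m else x m / 2 := by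
    have h := hA k ((A k).symm x) m
    rw [ContinuousLinearEquiv.apply_symm_apply] at h
    split_ifs at h ⊢ <;> linarith
  have hmemP (k : ℤ) (v : lp (fun _ : ℤ => ℝ) p) :
      v ∈ Set.range (P k) ↔ ∀ m, k < m → v m = 0 := by
    constructor
    · rintro ⟨x, rfl⟩ m hm
      rw [hP, if_neg hm.not_ge]
    · refine fun h => ⟨v, lp.ext (funext fun m => ?_)⟩
      rw [hP]
      split_ifs with hm
      · rfl
      · exact (h m (not_le.mp hm)).symm
  have hmemQ (k : ℤ) (v : lp (fun _ : ℤ => ℝ) p) :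
      v ∈ Set.range (Q k) ↔ ∀ m, m ≤ k → v m = 0 := by
    constructor
    · rintro ⟨x, rfl⟩ m hm
      rw [hQ', if_pos hm]
    · refine fun h => ⟨v, lp.ext (funext fun m => ?_)⟩
      rw [hQ']
      split_ifs with hm
      · exact (h m hm).symm
      · rfl
  refine ⟨⟨fun k => ?_, fun k => ?_, fun k => ?_, fun k v hv => ?_, fun k v hv => ?_,
    fun k n v hv => ?_, fun k n v hv => ?_⟩, ?_, fun hED => ?_⟩
  · rw [hQ, add_sub_cancel]
  · refine ContinuousLinearMap.opNorm_le_bound _ zero_le_one fun x => ?_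
    rw [one_mul]
    refine lp_norm_le_of_forall_norm_le hp fun m => ?_
    rw [hP]
    split_ifs <;> simp
  · refine ContinuousLinearMap.opNorm_le_bound _ zero_le_one fun x => ?_
    rw [one_mul]
    refine lp_norm_le_of_forall_norm_le hp fun m => ?_
    rw [hQ']
    split_ifs <;> simp
  · rw [hmemP] at hv ⊢
    intro m hm
    rw [hA, hv m (by omega)]
    simp
  · rw [hmemQ] at hv ⊢
    intro m hm
    rw [hA', hv m (by omega)]
    simp
  · rw [hmemP] at hv
    have h : fwd A k n v = (1 / 2 : ℝ) ^ n • v := by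
      induction n with
      | zero => simp [fwd]
      | succ n ih =>
        refine lp.ext (funext fun m => ?_)
        rw [fwd, ContinuousLinearMap.comp_apply, ih, ContinuousLinearEquiv.coe_coe, hA]
        simp only [lp.coeFn_smul, Pi.smul_apply, smul_eq_mul]
        split_ifs with hm
        · ring
        · rw [hv m (by omega)]
          ring
    rw [h, norm_smul, Real.norm_of_nonneg (by positivity), one_mul]
  · rw [hmemQ] at hv
    have h : bwd A k n v = (1 / 2 : ℝ) ^ n • v := by
      induction n with
      | zero => simp [bwd]
      | succ n ih =>
        refine lp.ext (funext fun m => ?_)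
        rw [bwd, ContinuousLinearMap.comp_apply, ih, ContinuousLinearEquiv.coe_coe, hA']
        simp only [lp.coeFn_smul, Pi.smul_apply, smul_eq_mul]
        split_ifs with hm
        · rw [hv m (by omega)]
          ring
        · ring
    rw [h, norm_smul, Real.norm_of_nonneg (by positivity), one_mul]
  all_goals
    have hne (i : ℤ) : lp.single (E := fun _ : ℤ => ℝ) p i 1 ≠ 0 := fun h => by
      simpa using congrArg (fun x : lp (fun _ : ℤ => ℝ) p => x i) h
  · refine not_EDOn_of_transient_growth fun N =>
      ⟨lp.single p (N : ℤ) 1, hne _, fun k hk => ?_, fun k hk => ?_⟩ <;>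
    · refine lp.ext (funext fun m => ?_)
      rw [hA, lp.coeFn_smul, Pi.smul_apply, smul_eq_mul]
      rcases eq_or_ne m N with rfl | hm
      · simp [hk]
      · simp [Pi.single_eq_of_ne hm]
  · refine not_EDOn_of_transient_growth (fun N =>
      ⟨lp.single p (-N : ℤ) 1, hne _, fun k hk => ?_, fun k hk => ?_⟩) hED.timeReversal <;>
    · refine lp.ext (funext fun m => ?_)
      rw [timeReversal, hA', lp.coeFn_smul, Pi.smul_apply, smul_eq_mul]
      rcases eq_or_ne m (-N) with rfl | hm
      · split_ifs <;> first | omega | simp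
      · simp [Pi.single_eq_of_ne hm]

end
end

section
/- Let λ ∈ (0,1), R > 1/λ, M > 1, and let a_k : ℝ → ℝ (k ∈ ℤ) be C² diffeomorphisms with a_k(0) = 0, a_k'(x) ∈ (1/λ, R) for all x when k < 0, a_k'(x) ∈ (1/R, λ) for all x when k ≥ 0, and |a_k''(x)| ≤ M, |(a_k⁻¹)''(x)| ≤ M for all x. Let B = ℓ^p(ℤ), p ∈ [1,∞], and define f : B → B by f({x_k}) = {y_k} with y_{k+1} = a_k(x_k). Then f is a well-defined C¹ diffeomorphism of B satisfying the C¹ regularity conditions (with r(z) = Mz and constant R) and a generalized (C,λ)-structure with C = 1, with splitting E⁺ = {v ∈ B : v_k = 0 for k < 0}, E⁻ = {v ∈ B : v_k = 0 for k ≥ 0} (independent of the base point), Eˢ_x = E⁺ and Eᵘ_x = E⁻ for all x. -/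
open Set Filter

noncomputable section

variable {B : Type*} [NormedAddCommGroup B] [NormedSpace ℝ B] [CompleteSpace B]

/-- The sequence space `ℓ^p(ℤ)`. -/
abbrev lpZ (p : ENNReal) := lp (fun _ : ℤ => ℝ) p

/-- A sequence that is coordinatewise dominated, after relabelling the index set, by `c` times
another one has norm at most `c` times the norm of the latter. -/
theorem lpZ_norm_le_of_coord_le {p : ENNReal} [Fact (1 ≤ p)] (e : ℤ ≃ ℤ) {c : ℝ} (hc : 0 ≤ c)
    {w v : lpZ p} (h : ∀ k, |w (e k)| ≤ c * |v k|) : ‖w‖ ≤ c * ‖v‖ := by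
  have hp0 : p ≠ 0 := (zero_lt_one.trans_le (Fact.out : 1 ≤ p)).ne'
  have hcv : 0 ≤ c * ‖v‖ := mul_nonneg hc (norm_nonneg _)
  by_cases hp : p = ⊤
  · subst hp
    refine lp.norm_le_of_forall_le hcv fun i => ?_
    obtain ⟨k, rfl⟩ := e.surjective i
    exact (h k).trans (mul_le_mul_of_nonneg_left (lp.norm_apply_le_norm ENNReal.top_ne_zero v k) hc)
  · have hpr : 0 < p.toReal := ENNReal.toReal_pos hp0 hp
    refine lp.norm_le_of_forall_sum_le hpr hcv fun s => ?_
    calc ∑ i ∈ s, ‖w i‖ ^ p.toReal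
        ≤ ∑ i ∈ s, c ^ p.toReal * ‖v (e.symm i)‖ ^ p.toReal := by
          refine Finset.sum_le_sum fun i _ => ?_
          rw [← Real.mul_rpow hc (norm_nonneg _)]
          refine Real.rpow_le_rpow (norm_nonneg _) ?_ hpr.le
          simpa using h (e.symm i)
      _ = c ^ p.toReal * ∑ j ∈ s.map e.symm.toEmbedding, ‖v j‖ ^ p.toReal := by
          rw [Finset.mul_sum, Finset.sum_map]; rfl
      _ ≤ c ^ p.toReal * ‖v‖ ^ p.toReal :=
          mul_le_mul_of_nonneg_left (lp.sum_rpow_le_norm_rpow hpr v _) (Real.rpow_nonneg hc _)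
      _ = (c * ‖v‖) ^ p.toReal := (Real.mul_rpow hc (norm_nonneg _)).symm

theorem abs_sub_le_of_hasDerivAt_of_abs_le {g g' : ℝ → ℝ} {M : ℝ}
    (hg : ∀ x, HasDerivAt g (g' x) x) (hM : ∀ x, |g' x| ≤ M) (x y : ℝ) :
    |g y - g x| ≤ M * |y - x| :=
  convex_univ.norm_image_sub_le_of_norm_hasDerivWithin_le
    (fun t _ => (hg t).hasDerivWithinAt) (fun t _ => hM t) (mem_univ x) (mem_univ y)

/-- First order Taylor estimate for a function with bounded second derivative. -/
theorem abs_taylor_remainder_le {g g' g'' : ℝ → ℝ} {M : ℝ}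
    (hg : ∀ x, HasDerivAt g (g' x) x) (hg' : ∀ x, HasDerivAt g' (g'' x) x)
    (hM : ∀ x, |g'' x| ≤ M) (x v : ℝ) :
    |g (x + v) - g x - g' x * v| ≤ M * |v| * |v| := by
  have hM0 : 0 ≤ M := (abs_nonneg _).trans (hM x)
  have key := (convex_uIcc x (x + v)).norm_image_sub_le_of_norm_hasDerivWithin_le
    (f := fun t => g t - g' x * t) (f' := fun t => g' t - g' x) (C := M * |v|)
    (fun t _ => ((hg t).sub (by simpa using (hasDerivAt_id t).const_mul (g' x))).hasDerivWithinAt)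
    (fun t ht => (abs_sub_le_of_hasDerivAt_of_abs_le hg' hM x t).trans
      (mul_le_mul_of_nonneg_left (by simpa using abs_sub_left_of_mem_uIcc ht) hM0))
    left_mem_uIcc right_mem_uIcc
  simp only [Real.norm_eq_abs, add_sub_cancel_left] at key
  convert key using 2
  ring

section WeightedShift

variable {p : ENNReal} [Fact (1 ≤ p)] {e : ℤ ≃ ℤ} {F : lpZ p → lpZ p}
  {DF : lpZ p → lpZ p →L[ℝ] lpZ p} {b b' b'' : ℤ → ℝ → ℝ} {M : ℝ}

theorem norm_weightedShift_remainder_le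
    (hF : ∀ x k, F x (e k) = b k (x k)) (hDF : ∀ x v k, DF x v (e k) = b' k (x k) * v k)
    (hb : ∀ k x, HasDerivAt (b k) (b' k x) x) (hb' : ∀ k x, HasDerivAt (b' k) (b'' k x) x)
    (hM : ∀ k x, |b'' k x| ≤ M) (x v : lpZ p) :
    ‖F (x + v) - F x - DF x v‖ ≤ M * ‖v‖ * ‖v‖ := by
  have hp0 : p ≠ 0 := (zero_lt_one.trans_le (Fact.out : 1 ≤ p)).ne'
  have hM0 : 0 ≤ M := (abs_nonneg _).trans (hM 0 0)
  refine lpZ_norm_le_of_coord_le e (by positivity) fun k => ?_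
  have h := abs_taylor_remainder_le (hb k) (hb' k) (hM k) (x k) (v k)
  have hv : |v k| ≤ ‖v‖ := lp.norm_apply_le_norm hp0 v k
  simp only [lp.coeFn_sub, Pi.sub_apply, hF, hDF, lp.coeFn_add, Pi.add_apply]
  exact h.trans (by gcongr)

theorem hasFDerivAt_weightedShift
    (hF : ∀ x k, F x (e k) = b k (x k)) (hDF : ∀ x v k, DF x v (e k) = b' k (x k) * v k)
    (hb : ∀ k x, HasDerivAt (b k) (b' k x) x) (hb' : ∀ k x, HasDerivAt (b' k) (b'' k x) x)
    (hM : ∀ k x, |b'' k x| ≤ M) (x : lpZ p) : HasFDerivAt F (DF x) x := by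
  rw [hasFDerivAt_iff_isLittleO_nhds_zero]
  refine Asymptotics.IsBigO.trans_isLittleO (g := fun v : lpZ p => ‖v‖ ^ 2) ?_
    (Asymptotics.isLittleO_norm_pow_id one_lt_two)
  refine Asymptotics.IsBigO.of_bound M (Eventually.of_forall fun v => ?_)
  have h := norm_weightedShift_remainder_le hF hDF hb hb' hM x v
  rw [norm_pow, norm_norm]
  linarith

theorem norm_weightedShift_deriv_le
    (hDF : ∀ x v k, DF x v (e k) = b' k (x k) * v k) {R : ℝ} (hR : 0 ≤ R)
    (hb : ∀ k x, |b' k x| ≤ R) (x : lpZ p) : ‖DF x‖ ≤ R := by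
  refine ContinuousLinearMap.opNorm_le_bound _ hR fun v =>
    lpZ_norm_le_of_coord_le e hR fun k => ?_
  rw [hDF, abs_mul]
  exact mul_le_mul_of_nonneg_right (hb k _) (abs_nonneg _)

theorem norm_weightedShift_deriv_sub_le
    (hDF : ∀ x v k, DF x v (e k) = b' k (x k) * v k)
    (hb' : ∀ k x, HasDerivAt (b' k) (b'' k x) x)
    (hM : ∀ k x, |b'' k x| ≤ M) (x v : lpZ p) : ‖DF (x + v) - DF x‖ ≤ M * ‖v‖ := by
  have hp0 : p ≠ 0 := (zero_lt_one.trans_le (Fact.out : 1 ≤ p)).ne'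
  have hM0 : 0 ≤ M := (abs_nonneg _).trans (hM 0 0)
  refine ContinuousLinearMap.opNorm_le_bound _ (by positivity) fun w =>
    lpZ_norm_le_of_coord_le e (by positivity) fun k => ?_
  have h := abs_sub_le_of_hasDerivAt_of_abs_le (hb' k) (hM k) (x k) (x k + v k)
  have hv : |v k| ≤ ‖v‖ := lp.norm_apply_le_norm hp0 v k
  rw [add_sub_cancel_left] at h
  simp only [sub_apply, lp.coeFn_sub, Pi.sub_apply, hDF, lp.coeFn_add,
    Pi.add_apply]
  rw [← sub_mul, abs_mul]
  exact mul_le_mul_of_nonneg_right (h.trans (by gcongr)) (abs_nonneg _)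

/-- The derivative cocycle contracts sequences supported on a forward invariant set of indices on
which all the weights are at most `lam`. -/
theorem norm_orbitDeriv_weightedShift_le
    (hDF : ∀ x v k, DF x v (e k) = b' k (x k) * v k) {S : Set ℤ} (hS : ∀ k ∈ S, e k ∈ S)
    {lam : ℝ} (hlam : 0 ≤ lam) (hb : ∀ k ∈ S, ∀ x, |b' k x| ≤ lam)
    (n : ℕ) (x v : lpZ p) (hv : ∀ k, k ∉ S → v k = 0) :
    ‖orbitDeriv F DF n x v‖ ≤ lam ^ n * ‖v‖ := by
  induction n generalizing x v with
  | zero => simp [orbitDeriv]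
  | succ n ih =>
    have hsupp : ∀ k, k ∉ S → DF x v k = 0 := fun k hk => by
      obtain ⟨j, rfl⟩ := e.surjective k
      rw [hDF, hv j fun hj => hk (hS j hj), mul_zero]
    have hstep : ‖DF x v‖ ≤ lam * ‖v‖ := lpZ_norm_le_of_coord_le e hlam fun k => by
      rw [hDF, abs_mul]
      by_cases hk : k ∈ S
      · exact mul_le_mul_of_nonneg_right (hb k hk _) (abs_nonneg _)
      · simp [hv k hk]
    calc ‖orbitDeriv F DF (n + 1) x v‖ = ‖orbitDeriv F DF n (F x) (DF x v)‖ := rfl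
      _ ≤ lam ^ n * ‖DF x v‖ := ih _ _ hsupp
      _ ≤ lam ^ n * (lam * ‖v‖) := by gcongr
      _ = lam ^ (n + 1) * ‖v‖ := by ring

end WeightedShift

/-- Nonlinear weighted shift: `f({x_k}) = {y_k}`, `y_{k+1} = a_k(x_k)`,
on `ℓ^p(ℤ)`, with expanding `a_k` for `k < 0` and contracting `a_k` for `k ≥ 0`, is a
`C¹` diffeomorphism satisfying the `C¹` regularity conditions (with `r(z) = Mz` and
constant `R`) and a generalized `(1, λ)`-structure with constant splitting
`Eˢ = E⁺`, `Eᵘ = E⁻`. -/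
theorem statement18 (p : ENNReal) [Fact (1 ≤ p)]
    (lam R M : ℝ) (hlam : lam ∈ Set.Ioo (0 : ℝ) 1) (hRlam : 1 / lam < R) (hM : 1 < M)
    (a aInv a' a'' aInv' aInv'' : ℤ → ℝ → ℝ)
    (hinv₁ : ∀ k, Function.LeftInverse (aInv k) (a k))
    (hinv₂ : ∀ k, Function.RightInverse (aInv k) (a k))
    (ha0 : ∀ k, a k 0 = 0)
    (hd : ∀ k x, HasDerivAt (a k) (a' k x) x)
    (hdInv : ∀ k x, HasDerivAt (aInv k) (aInv' k x) x)
    (hd2 : ∀ k x, HasDerivAt (a' k) (a'' k x) x)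
    (hd2Inv : ∀ k x, HasDerivAt (aInv' k) (aInv'' k x) x)
    (hneg : ∀ k : ℤ, k < 0 → ∀ x : ℝ, a' k x ∈ Set.Ioo (1 / lam) R)
    (hnonneg : ∀ k : ℤ, 0 ≤ k → ∀ x : ℝ, a' k x ∈ Set.Ioo (1 / R) lam)
    (h2bd : ∀ k x, |a'' k x| ≤ M) (h2bdInv : ∀ k x, |aInv'' k x| ≤ M)
    (f fInv : lpZ p → lpZ p) (Df DfInv : lpZ p → lpZ p →L[ℝ] lpZ p)
    (hfdef : ∀ (x : lpZ p) (k : ℤ), f x (k + 1) = a k (x k))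
    (hfInvdef : ∀ (x : lpZ p) (k : ℤ), fInv x k = aInv k (x (k + 1)))
    (hDfdef : ∀ (x v : lpZ p) (k : ℤ), Df x v (k + 1) = a' k (x k) * v k)
    (hDfInvdef : ∀ (x v : lpZ p) (k : ℤ), DfInv x v k = aInv' k (x (k + 1)) * v (k + 1))
    (P Q : lpZ p → lpZ p →L[ℝ] lpZ p)
    (hPdef : ∀ (x v : lpZ p) (k : ℤ), P x v k = if 0 ≤ k then v k else 0)
    (hQdef : ∀ x : lpZ p, Q x = ContinuousLinearMap.id ℝ (lpZ p) - P x) :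
    IsC1Diffeo f fInv Df DfInv ∧
    C1Reg f Df DfInv R (fun z => M * z) ∧
    IsGenCL f fInv Df DfInv 1 lam P Q ∧
    (∀ x : lpZ p, Set.range (P x) = {v : lpZ p | ∀ k : ℤ, k < 0 → v k = 0}) ∧
    (∀ x : lpZ p, Set.range (Q x) = {v : lpZ p | ∀ k : ℤ, 0 ≤ k → v k = 0}) := by
  obtain ⟨hl0, hl1⟩ := hlam
  have hl1' : 1 < 1 / lam := by rw [lt_div_iff₀ hl0]; linarith
  have hR0 : 0 < R := by linarith
  have hM0 : 0 < M := by linarith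
  have hRinv : 0 < 1 / R := by positivity
  have ha'inv : ∀ k x, aInv' k x = (a' k (aInv k x))⁻¹ := fun k x => by
    have h := ((hd k (aInv k x)).comp x (hdInv k x)).unique
      ((hasDerivAt_id x).congr_of_eventuallyEq (Eventually.of_forall (hinv₂ k)))
    exact eq_inv_of_mul_eq_one_right h
  have ha'R : ∀ k x, |a' k x| ≤ R := fun k x => by
    rcases lt_or_ge k 0 with hk | hk
    · have h := hneg k hk x
      rw [abs_of_pos (by linarith [h.1])]; exact h.2.le
    · have h := hnonneg k hk x
      rw [abs_of_pos (hRinv.trans h.1)]; linarith [h.2]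
  have ha'lam : ∀ k, 0 ≤ k → ∀ x, |a' k x| ≤ lam := fun k hk x => by
    have h := hnonneg k hk x
    rw [abs_of_pos (hRinv.trans h.1)]; exact h.2.le
  have haInv'lam : ∀ k < 0, ∀ x, |aInv' k x| ≤ lam := fun k hk x => by
    have h := (hneg k hk (aInv k x)).1
    rw [ha'inv, abs_of_pos (inv_pos.2 (by linarith))]
    exact inv_le_of_inv_le₀ hl0 (by rw [← one_div]; exact h.le)
  have haInv'R : ∀ k x, |aInv' k x| ≤ R := fun k x => by
    rcases lt_or_ge k 0 with hk | hk
    · linarith [haInv'lam k hk x]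
    · have h := (hnonneg k hk (aInv k x)).1
      rw [ha'inv, abs_of_pos (inv_pos.2 (hRinv.trans h))]
      exact inv_le_of_inv_le₀ hR0 (by rw [← one_div]; exact h.le)
  have hF : ∀ x k, f x (Equiv.addRight (1 : ℤ) k) = a k (x k) := hfdef
  have hDF : ∀ x v k, Df x v (Equiv.addRight (1 : ℤ) k) = a' k (x k) * v k := hDfdef
  have hG : ∀ x k, fInv x (Equiv.subRight (1 : ℤ) k) = aInv (k - 1) (x k) := fun x k => by
    simp [hfInvdef]
  have hDG : ∀ x v k, DfInv x v (Equiv.subRight (1 : ℤ) k) = aInv' (k - 1) (x k) * v k :=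
    fun x v k => by simp [hDfInvdef]
  have hQ : ∀ x v k, Q x v k = if 0 ≤ k then 0 else v k := fun x v k => by
    rw [hQdef, sub_apply, lp.coeFn_sub, Pi.sub_apply, hPdef]
    split_ifs <;> simp
  have hPrange : ∀ x, Set.range (P x) = {v : lpZ p | ∀ k : ℤ, k < 0 → v k = 0} := fun x => by
    refine Subset.antisymm ?_ fun v hv => ⟨v, ?_⟩
    · rintro _ ⟨v, rfl⟩ k hk
      rw [hPdef, if_neg hk.not_ge]
    · ext k
      rw [hPdef]
      split_ifs with hk
      · rfl
      · exact (hv k (not_le.1 hk)).symm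
  have hQrange : ∀ x, Set.range (Q x) = {v : lpZ p | ∀ k : ℤ, 0 ≤ k → v k = 0} := fun x => by
    refine Subset.antisymm ?_ fun v hv => ⟨v, ?_⟩
    · rintro _ ⟨v, rfl⟩ k hk
      rw [hQ, if_pos hk]
    · ext k
      rw [hQ]
      split_ifs with hk
      · exact (hv k hk).symm
      · rfl
  refine ⟨⟨fun x => ?_, fun x => ?_, hasFDerivAt_weightedShift hF hDF hd hd2 h2bd,
      hasFDerivAt_weightedShift hG hDG (fun k => hdInv (k - 1)) (fun k => hd2Inv (k - 1))
        (fun k => h2bdInv (k - 1))⟩,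
    ⟨hR0, fun y _ z _ hyz => mul_le_mul_of_nonneg_left hyz hM0.le,
      fun z hz => mul_nonneg hM0.le hz, ?_, fun x v => ?_,
      norm_weightedShift_deriv_le hDF hR0.le ha'R,
      norm_weightedShift_deriv_le hDG hR0.le (fun k => haInv'R (k - 1)),
      norm_weightedShift_deriv_sub_le hDF hd2 h2bd⟩,
    ⟨fun x => ?_, fun x => ?_, fun x => ?_, fun x => ?_, fun x => ?_, fun x n v hv => ?_,
      fun x n v hv => ?_⟩, hPrange, hQrange⟩
  · ext k
    rw [hfInvdef, hfdef, hinv₁]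
  · ext k
    obtain ⟨j, rfl⟩ := (Equiv.addRight (1 : ℤ)).surjective k
    rw [hF, hfInvdef, hinv₂]; rfl
  · have h : Tendsto (fun z : ℝ => M * z) (nhds 0) (nhds (M * 0)) :=
      (continuous_const_mul M).tendsto 0
    rw [mul_zero] at h
    exact h.mono_left nhdsWithin_le_nhds
  · rw [mul_comm]
    exact norm_weightedShift_remainder_le hF hDF hd hd2 h2bd x v
  · rw [hQdef, add_sub_cancel]
  · refine ContinuousLinearMap.opNorm_le_bound _ zero_le_one fun v =>
      lpZ_norm_le_of_coord_le (Equiv.refl ℤ) zero_le_one fun k => ?_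
    rw [Equiv.refl_apply, hPdef]
    split_ifs <;> simp
  · refine ContinuousLinearMap.opNorm_le_bound _ zero_le_one fun v =>
      lpZ_norm_le_of_coord_le (Equiv.refl ℤ) zero_le_one fun k => ?_
    rw [Equiv.refl_apply, hQ]
    split_ifs <;> simp
  · rw [hPrange, hPrange]
    intro v hv k hk
    obtain ⟨j, rfl⟩ := (Equiv.addRight (1 : ℤ)).surjective k
    have hj : j + 1 < 0 := hk
    rw [hDF, hv j (by omega), mul_zero]
  · rw [hQrange, hQrange]
    intro v hv k hk
    rw [hDfInvdef, hv (k + 1) (by omega), mul_zero]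
  · rw [hPrange] at hv
    rw [one_mul]
    exact norm_orbitDeriv_weightedShift_le (S := Ici 0) hDF
      (fun k (hk : 0 ≤ k) => show 0 ≤ k + 1 by omega) hl0.le ha'lam n x v
      fun k hk => hv k (not_le.1 hk)
  · rw [hQrange] at hv
    rw [one_mul]
    exact norm_orbitDeriv_weightedShift_le (S := Iio 0) hDG
      (fun k (hk : k < 0) => show k - 1 < 0 by omega) hl0.le
      (fun k (hk : k < 0) => haInv'lam (k - 1) (by omega)) n x v
      fun k hk => hv k (not_lt.1 hk)

end
end

section
/- Let 0 < λ₁ < 1, M > 0, C > 0, λ ∈ (0,1), and let a : ℝ → ℝ be a C² diffeomorphism satisfying for all x ∈ ℝ: |a(x)| < |x|/λ₁, |a⁻¹(x)| < |x|/λ₁, a'(x) ∈ (λ₁, 1/λ₁), |a''(x)| ≤ M. Define the splitting of ℝ by Fˢ_x = ℝ if |x| > 1/2 and Fˢ_x = {0} if |x| ≤ 1/2, with Fᵘ_x the complementary line, and assume a satisfies the one-dimensional (C,λ)-structure with this splitting: if |x| > 1/2 then |a(x)| > 1/2 and |(aⁿ)'(x)| ≤ Cλⁿ for all n ≥ 0,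 and if |x| ≤ 1/2 then |a⁻¹(x)| ≤ 1/2 and |(a⁻ⁿ)'(x)| ≤ Cλⁿ for all n ≥ 0. Let B = ℓ^p(ℤ), p ∈ [1,∞], and define f : B → B coordinatewise by f({x_k}) = {a(x_k)}. Then f is a well-defined C¹ diffeomorphism of B satisfying the C¹ regularity conditions (with r(z) = Mz) and a generalized (C,λ)-structure with the same constants C and λ, with splitting Eˢ_x = {v ∈ B : v_k = 0 if |x_k| ≤ 1/2} and Eᵘ_x = {v ∈ B : v_k = 0 if |x_k| > 1/2} for x = {x_k}. -/
open Set Filter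

noncomputable section

variable {B : Type*} [NormedAddCommGroup B] [NormedSpace ℝ B] [CompleteSpace B]

/-- Coordinatewise domination implies domination of the `ℓ^p` norms. -/
theorem lpZ_norm_le_mul {p : ENNReal} [Fact (1 ≤ p)] {u v : lpZ p} {c : ℝ} (hc : 0 ≤ c)
    (h : ∀ k, |u k| ≤ c * |v k|) : ‖u‖ ≤ c * ‖v‖ := by
  have hp : p ≠ 0 := (zero_lt_one.trans_le (Fact.out : 1 ≤ p)).ne'
  have h' : ∀ k, ‖u k‖ ≤ ‖(c • v) k‖ := fun k => by
    simpa [Real.norm_eq_abs, abs_mul, abs_of_nonneg hc] using h k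
  have key : ‖u‖ ≤ ‖c • v‖ := by
    rcases eq_or_ne p ⊤ with rfl | htop
    · exact lp.norm_le_of_forall_le (norm_nonneg _) fun k =>
        (h' k).trans (lp.norm_apply_le_norm hp _ k)
    · have hpos : 0 < p.toReal := ENNReal.toReal_pos hp htop
      refine lp.norm_le_of_tsum_le hpos (norm_nonneg _) ?_
      rw [lp.norm_rpow_eq_tsum hpos]
      exact Summable.tsum_le_tsum
        (fun k => Real.rpow_le_rpow (norm_nonneg _) (h' k) hpos.le)
        ((lp.memℓp u).summable hpos) ((lp.memℓp (c • v)).summable hpos)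
  rwa [norm_smul, Real.norm_eq_abs, abs_of_nonneg hc] at key

/-- A real function whose derivative is bounded by `K` is `K`-Lipschitz. -/
theorem abs_sub_le_of_hasDerivAt {b b' : ℝ → ℝ} {K : ℝ} (hb : ∀ x, HasDerivAt b (b' x) x)
    (hK : ∀ x, |b' x| ≤ K) (x y : ℝ) : |b y - b x| ≤ K * |y - x| :=
  Convex.norm_image_sub_le_of_norm_hasDerivWithin_le (s := univ)
    (fun z _ => (hb z).hasDerivWithinAt) (fun z _ => hK z) convex_univ (mem_univ x) (mem_univ y)

/-- The first-order Taylor remainder of a function with `K`-Lipschitz derivative is quadratic. -/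
theorem abs_taylor_remainder_le_s19 {b b' : ℝ → ℝ} {K : ℝ} (hK : 0 ≤ K)
    (hb : ∀ x, HasDerivAt b (b' x) x) (hL : ∀ x y, |b' y - b' x| ≤ K * |y - x|) (x v : ℝ) :
    |b (x + v) - b x - b' x * v| ≤ K * |v| * |v| := by
  have hder : ∀ t, HasDerivAt (fun t => b t - b' x * t) (b' t - b' x) t := fun t => by
    simpa using (hb t).fun_sub ((hasDerivAt_id t).const_mul (b' x))
  have hbound : ∀ t ∈ uIcc x (x + v), ‖b' t - b' x‖ ≤ K * |v| := fun t ht =>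
    (hL x t).trans <| mul_le_mul_of_nonneg_left
      (by simpa using abs_sub_left_of_mem_uIcc ht) hK
  have := Convex.norm_image_sub_le_of_norm_hasDerivWithin_le
    (fun t _ => (hder t).hasDerivWithinAt) hbound (convex_uIcc x (x + v))
    left_mem_uIcc right_mem_uIcc
  rw [add_sub_cancel_left, Real.norm_eq_abs, Real.norm_eq_abs] at this
  convert this using 2
  ring

section Diagonal

variable {p : ENNReal} [Fact (1 ≤ p)] {b b' : ℝ → ℝ} {g : lpZ p → lpZ p} {Dg : lpZ p → lpZ p →L[ℝ] lpZ p}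

theorem lpZ_taylor_remainder_le {K : ℝ} (hK : 0 ≤ K)
    (hb : ∀ x, HasDerivAt b (b' x) x) (hL : ∀ x y, |b' y - b' x| ≤ K * |y - x|)
    (hg : ∀ (x : lpZ p) (k : ℤ), g x k = b (x k))
    (hDg : ∀ (x v : lpZ p) (k : ℤ), Dg x v k = b' (x k) * v k) (x v : lpZ p) :
    ‖g (x + v) - g x - Dg x v‖ ≤ K * ‖v‖ * ‖v‖ := by
  have hp : p ≠ 0 := (zero_lt_one.trans_le (Fact.out : 1 ≤ p)).ne'
  refine lpZ_norm_le_mul (by positivity) fun k => ?_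
  have hvk : |v k| ≤ ‖v‖ := lp.norm_apply_le_norm hp v k
  have := abs_taylor_remainder_le_s19 hK hb hL (x k) (v k)
  simp only [lp.coeFn_sub, Pi.sub_apply, hg, hDg, lp.coeFn_add, Pi.add_apply]
  exact this.trans (by gcongr)

theorem lpZ_hasFDerivAt {K : ℝ} (hK : 0 ≤ K)
    (hb : ∀ x, HasDerivAt b (b' x) x) (hL : ∀ x y, |b' y - b' x| ≤ K * |y - x|)
    (hg : ∀ (x : lpZ p) (k : ℤ), g x k = b (x k))
    (hDg : ∀ (x v : lpZ p) (k : ℤ), Dg x v k = b' (x k) * v k) (x : lpZ p) :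
    HasFDerivAt g (Dg x) x := by
  rw [hasFDerivAt_iff_isLittleO_nhds_zero]
  refine Asymptotics.IsBigO.trans_isLittleO (g := fun v : lpZ p => ‖v‖ ^ 2) ?_
    (Asymptotics.isLittleO_norm_pow_id one_lt_two)
  refine Asymptotics.IsBigO.of_bound K (Eventually.of_forall fun v => ?_)
  have := lpZ_taylor_remainder_le hK hb hL hg hDg x v
  rw [norm_pow, norm_norm]
  linarith

theorem lpZ_norm_diagonal_le {R : ℝ} (hR : ∀ x, |b' x| ≤ R)
    (hDg : ∀ (x v : lpZ p) (k : ℤ), Dg x v k = b' (x k) * v k) (x : lpZ p) : ‖Dg x‖ ≤ R := by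
  have hR0 : 0 ≤ R := (abs_nonneg _).trans (hR 0)
  refine ContinuousLinearMap.opNorm_le_bound _ hR0 fun v => ?_
  refine lpZ_norm_le_mul hR0 fun k => ?_
  rw [hDg, abs_mul]
  exact mul_le_mul_of_nonneg_right (hR _) (abs_nonneg _)

theorem lpZ_orbitDeriv_apply
    (hg : ∀ (x : lpZ p) (k : ℤ), g x k = b (x k))
    (hDg : ∀ (x v : lpZ p) (k : ℤ), Dg x v k = b' (x k) * v k) (n : ℕ) (x v : lpZ p) (k : ℤ) :
    orbitDeriv g Dg n x v k = (∏ i ∈ Finset.range n, b' (b^[i] (x k))) * v k := by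
  induction n generalizing x v with
  | zero => simp [orbitDeriv]
  | succ n ih =>
    rw [orbitDeriv, ContinuousLinearMap.comp_apply, ih, hg, hDg, Finset.prod_range_succ']
    simp only [Function.iterate_succ_apply, Function.iterate_zero_apply]
    ring

/-- Coordinatewise bounds on the derivative products of `b` over the support of `v` give the
same bound on the orbit derivative of the diagonal map. -/
theorem lpZ_norm_orbitDeriv_le
    (hg : ∀ (x : lpZ p) (k : ℤ), g x k = b (x k))
    (hDg : ∀ (x v : lpZ p) (k : ℤ), Dg x v k = b' (x k) * v k) {n : ℕ} {x v : lpZ p} {c : ℝ}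
    (hc : 0 ≤ c)
    (h : ∀ k, v k ≠ 0 → |∏ i ∈ Finset.range n, b' (b^[i] (x k))| ≤ c) :
    ‖orbitDeriv g Dg n x v‖ ≤ c * ‖v‖ := by
  refine lpZ_norm_le_mul hc fun k => ?_
  rw [lpZ_orbitDeriv_apply hg hDg, abs_mul]
  rcases eq_or_ne (v k) 0 with hv | hv
  · simp [hv]
  · exact mul_le_mul_of_nonneg_right (h k hv) (abs_nonneg _)

end Diagonal

/-- The derivative of an inverse function of slope more than `c` is bounded by `c⁻¹`, and it is
Lipschitz if the derivative of the function is. -/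
theorem deriv_inverse_bounds {a aInv a' aInv' : ℝ → ℝ} {c K : ℝ} (hc : 0 < c)
    (hinv : Function.RightInverse aInv a)
    (hd : ∀ x, HasDerivAt a (a' x) x) (hdInv : ∀ x, HasDerivAt aInv (aInv' x) x)
    (hslope : ∀ x, c < a' x) (hK : 0 ≤ K) (hL : ∀ x y, |a' y - a' x| ≤ K * |y - x|) :
    (∀ y, |aInv' y| ≤ 1 / c) ∧
      ∀ x y, |aInv' y - aInv' x| ≤ 1 / c * (1 / c) * (K * (1 / c)) * |y - x| := by
  have hmul : ∀ y, a' (aInv y) * aInv' y = 1 := fun y => by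
    have h1 : HasDerivAt (a ∘ aInv) (a' (aInv y) * aInv' y) y := (hd _).comp y (hdInv y)
    rw [hinv.comp_eq_id] at h1
    exact h1.unique (hasDerivAt_id y)
  have hpos : ∀ y, 0 < a' y := fun y => hc.trans (hslope y)
  have heq : ∀ y, aInv' y = 1 / a' (aInv y) := fun y => by
    rw [eq_div_iff (hpos _).ne', mul_comm, hmul]
  have hbd : ∀ y, |aInv' y| ≤ 1 / c := fun y => by
    rw [heq, abs_of_pos (one_div_pos.2 (hpos _))]
    exact one_div_le_one_div_of_le hc (hslope _).le
  refine ⟨hbd, fun x y => ?_⟩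
  have hdiff : aInv' y - aInv' x = aInv' y * aInv' x * (a' (aInv x) - a' (aInv y)) := by
    linear_combination aInv' x * hmul y - aInv' y * hmul x
  rw [hdiff, abs_mul, abs_mul, mul_assoc _ (K * (1 / c))]
  have h1 : |a' (aInv x) - a' (aInv y)| ≤ K * (1 / c) * |y - x| := by
    rw [abs_sub_comm y, mul_assoc]
    exact (hL _ _).trans
      (mul_le_mul_of_nonneg_left (abs_sub_le_of_hasDerivAt hdInv hbd y x) hK)
  exact mul_le_mul (mul_le_mul (hbd _) (hbd _) (abs_nonneg _) (by positivity)) h1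
    (abs_nonneg _) (by positivity)

/-- Infinite product of a one-dimensional Morse–Smale-type
diffeomorphism: `f({x_k}) = {a(x_k)}` on `ℓ^p(ℤ)` is a `C¹` diffeomorphism satisfying
the `C¹` regularity conditions (with `r(z) = Mz`) and a generalized `(C, λ)`-structure
with splitting `Eˢ_x = {v : v_k = 0 if |x_k| ≤ 1/2}`, `Eᵘ_x = {v : v_k = 0 if |x_k| > 1/2}`. -/
theorem statement19 (p : ENNReal) [Fact (1 ≤ p)]
    (lam₁ M C lam : ℝ) (hlam₁ : lam₁ ∈ Set.Ioo (0 : ℝ) 1) (hM : 0 < M)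
    (hC : 0 < C) (hlam : lam ∈ Set.Ioo (0 : ℝ) 1)
    (a aInv a' a'' aInv' : ℝ → ℝ)
    (hinv₁ : Function.LeftInverse aInv a) (hinv₂ : Function.RightInverse aInv a)
    (hbd : ∀ x : ℝ, x ≠ 0 → |a x| < |x| / lam₁)
    (hbdInv : ∀ x : ℝ, x ≠ 0 → |aInv x| < |x| / lam₁)
    (hd : ∀ x, HasDerivAt a (a' x) x)
    (hdInv : ∀ x, HasDerivAt aInv (aInv' x) x)
    (hslope : ∀ x, a' x ∈ Set.Ioo lam₁ (1 / lam₁))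
    (hd2 : ∀ x, HasDerivAt a' (a'' x) x) (h2bd : ∀ x, |a'' x| ≤ M)
    (hCLgt : ∀ x : ℝ, 1 / 2 < |x| → 1 / 2 < |a x| ∧
      ∀ n : ℕ, |∏ i ∈ Finset.range n, a' (a^[i] x)| ≤ C * lam ^ n)
    (hCLle : ∀ x : ℝ, |x| ≤ 1 / 2 → |aInv x| ≤ 1 / 2 ∧
      ∀ n : ℕ, |∏ i ∈ Finset.range n, aInv' (aInv^[i] x)| ≤ C * lam ^ n)
    (f fInv : lpZ p → lpZ p) (Df DfInv : lpZ p → lpZ p →L[ℝ] lpZ p)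
    (hfdef : ∀ (x : lpZ p) (k : ℤ), f x k = a (x k))
    (hfInvdef : ∀ (x : lpZ p) (k : ℤ), fInv x k = aInv (x k))
    (hDfdef : ∀ (x v : lpZ p) (k : ℤ), Df x v k = a' (x k) * v k)
    (hDfInvdef : ∀ (x v : lpZ p) (k : ℤ), DfInv x v k = aInv' (x k) * v k)
    (P Q : lpZ p → lpZ p →L[ℝ] lpZ p)
    (hPdef : ∀ (x v : lpZ p) (k : ℤ), P x v k = if 1 / 2 < |x k| then v k else 0)
    (hQdef : ∀ (x v : lpZ p) (k : ℤ), Q x v k = if 1 / 2 < |x k| then 0 else v k) :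
    IsC1Diffeo f fInv Df DfInv ∧
    (∃ R : ℝ, 0 < R ∧ C1Reg f Df DfInv R (fun z => M * z)) ∧
    IsGenCL f fInv Df DfInv C lam P Q ∧
    (∀ x : lpZ p, Set.range (P x) = {v : lpZ p | ∀ k : ℤ, |x k| ≤ 1 / 2 → v k = 0}) ∧
    (∀ x : lpZ p, Set.range (Q x) = {v : lpZ p | ∀ k : ℤ, 1 / 2 < |x k| → v k = 0}) := by
  have hp : p ≠ 0 := (zero_lt_one.trans_le (Fact.out : 1 ≤ p)).ne'
  obtain ⟨hlam₁0, -⟩ := hlam₁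
  have hL : ∀ x y, |a' y - a' x| ≤ M * |y - x| := abs_sub_le_of_hasDerivAt hd2 h2bd
  have ha' : ∀ x, |a' x| ≤ 1 / lam₁ := fun x => by
    rw [abs_of_pos (hlam₁0.trans (hslope x).1)]
    exact (hslope x).2.le
  obtain ⟨haInv', hLInv⟩ := deriv_inverse_bounds hlam₁0 hinv₂ hd hdInv
    (fun x => (hslope x).1) hM.le hL
  have hC1 : 1 ≤ C := by
    simpa using (hCLgt 1 (by norm_num)).2 0
  have hrangeP : ∀ x : lpZ p,
      Set.range (P x) = {v : lpZ p | ∀ k : ℤ, |x k| ≤ 1 / 2 → v k = 0} := fun x => by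
    ext v
    constructor
    · rintro ⟨u, rfl⟩ k hk
      rw [hPdef, if_neg hk.not_gt]
    · refine fun hv => ⟨v, lp.ext (funext fun k => ?_)⟩
      rw [hPdef]
      split_ifs with hk
      · rfl
      · exact (hv k (not_lt.1 hk)).symm
  have hrangeQ : ∀ x : lpZ p,
      Set.range (Q x) = {v : lpZ p | ∀ k : ℤ, 1 / 2 < |x k| → v k = 0} := fun x => by
    ext v
    constructor
    · rintro ⟨u, rfl⟩ k hk
      rw [hQdef, if_pos hk]
    · refine fun hv => ⟨v, lp.ext (funext fun k => ?_)⟩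
      rw [hQdef]
      split_ifs with hk
      · exact (hv k hk).symm
      · rfl
  have hpow : ∀ n : ℕ, 0 ≤ C * lam ^ n := fun n => mul_nonneg hC.le (pow_nonneg hlam.1.le n)
  refine ⟨⟨fun x => ?_, fun x => ?_, ?_, ?_⟩, ⟨1 / lam₁, by positivity, by positivity, ?_⟩,
    ⟨fun x => ?_, fun x => ?_, fun x => ?_, fun x => ?_, fun x => ?_, ?_, ?_⟩,
    hrangeP, hrangeQ⟩
  · exact lp.ext (funext fun k => by rw [hfInvdef, hfdef, hinv₁])
  · exact lp.ext (funext fun k => by rw [hfdef, hfInvdef, hinv₂])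
  · exact lpZ_hasFDerivAt hM.le hd hL hfdef hDfdef
  · exact lpZ_hasFDerivAt (by positivity) hdInv hLInv hfInvdef hDfInvdef
  · refine ⟨fun x _ y _ hxy => mul_le_mul_of_nonneg_left hxy hM.le,
      fun z hz => mul_nonneg hM.le hz, ?_, fun x v => ?_,
      lpZ_norm_diagonal_le ha' hDfdef, lpZ_norm_diagonal_le haInv' hDfInvdef, fun x v => ?_⟩
    · have : Tendsto (fun z : ℝ => M * z) (nhds 0) (nhds (M * 0)) :=
        (continuous_const_mul M).tendsto 0
      rw [mul_zero] at this
      exact this.mono_left nhdsWithin_le_nhds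
    · rw [mul_comm]
      exact lpZ_taylor_remainder_le hM.le hd hL hfdef hDfdef x v
    · refine ContinuousLinearMap.opNorm_le_bound _ (by positivity) fun w => ?_
      refine lpZ_norm_le_mul (by positivity) fun k => ?_
      have hvk : |v k| ≤ ‖v‖ := lp.norm_apply_le_norm hp v k
      have hxk := hL (x k) (x k + v k)
      rw [add_sub_cancel_left] at hxk
      simp only [sub_apply, lp.coeFn_sub, Pi.sub_apply, hDfdef,
        lp.coeFn_add, Pi.add_apply, ← sub_mul, abs_mul]
      exact mul_le_mul_of_nonneg_right
        (hxk.trans (mul_le_mul_of_nonneg_left hvk hM.le)) (abs_nonneg _)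
  · refine ContinuousLinearMap.ext fun v => lp.ext (funext fun k => ?_)
    simp only [add_apply, lp.coeFn_add, Pi.add_apply, hPdef, hQdef,
      ContinuousLinearMap.id_apply]
    split_ifs <;> simp
  · refine ContinuousLinearMap.opNorm_le_bound _ hC.le fun v => lpZ_norm_le_mul hC.le fun k => ?_
    rw [hPdef]
    split_ifs
    · exact le_mul_of_one_le_left (abs_nonneg _) hC1
    · rw [abs_zero]; positivity
  · refine ContinuousLinearMap.opNorm_le_bound _ hC.le fun v => lpZ_norm_le_mul hC.le fun k => ?_
    rw [hQdef]
    split_ifs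
    · rw [abs_zero]; positivity
    · exact le_mul_of_one_le_left (abs_nonneg _) hC1
  · rw [hrangeP, hrangeP]
    intro v hv k hk
    rw [hfdef] at hk
    rw [hDfdef, hv k (not_lt.1 fun h => hk.not_gt (hCLgt _ h).1), mul_zero]
  · rw [hrangeQ, hrangeQ]
    intro v hv k hk
    rw [hfInvdef] at hk
    rw [hDfInvdef, hv k (not_le.1 fun h => hk.not_ge (hCLle _ h).1), mul_zero]
  · intro x n v hv
    rw [hrangeP] at hv
    exact lpZ_norm_orbitDeriv_le hfdef hDfdef (hpow n) fun k hk =>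
      (hCLgt _ (not_le.1 fun h => hk (hv k h))).2 n
  · intro x n v hv
    rw [hrangeQ] at hv
    exact lpZ_norm_orbitDeriv_le hfInvdef hDfInvdef (hpow n) fun k hk =>
      (hCLle _ (not_lt.1 fun h => hk (hv k h))).2 n

end
end
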